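/- Let N ≥ 3 be an integer, k an odd positive integer, l = k·2^N, and let m ≥ 2N+1 be an odd integer; set n = m + l and assume n ≥ 15. Then, in ℚ[c_1,…,c_n], B̂_n/n ≡ c_1^l·(B̂_m/m) + l·(c_1^{n−12}c_3^4 + c_1^{n−15}c_3^5 + c_1^{n−5}c_2c_3 + c_1^{n−8}c_2c_3^2 + c_1^{n−7}c_7) + (−1)^{(m+1)/2}·(l/2)·(−c_1^n + c_1^{n−3}c_3 + c_1^{n−6}c_3^2 + c_1^{n−9}c_3^3) (mod 2^{N+1}ℤ_2[c_1,…,c_n]). -/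

import Mathlib

open Finsupp MvPolynomial

noncomputable section

/-- weight of a partition (given as the multiplicity function of its parts) -/
def wt (u : ℕ →₀ ℕ) : ℕ := u.sum fun i m => i * m

/-- degree (number of parts) -/
def deg (u : ℕ →₀ ℕ) : ℕ := u.sum fun _ m => m

/-- γ_u = Π_i (i+1)^{u_i} (u_i)! -/
def gam (u : ℕ →₀ ℕ) : ℕ := u.prod fun i m => (i + 1) ^ m * m.factorial

/-- τ_u = (−1)^{d(u)−1} (w(u)+d(u)−2)! / γ_u -/
def tau (u : ℕ →₀ ℕ) : ℚ :=
  (-1 : ℚ) ^ (deg u - 1) * (Nat.factorial (wt u + deg u - 2) : ℚ) / (gam u : ℚ)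

/-- p-adic valuation on ℚ with v_p(0) = ⊤ -/
def pval (p : ℕ) (x : ℚ) : WithTop ℤ :=
  if x = 0 then ⊤ else ((padicValRat p x : ℤ) : WithTop ℤ)

/-- divided universal Bernoulli number B̂_n/n = Σ_{w(u)=n} τ_u c^u, as a
multivariate polynomial in the variables c_1, c_2, … (variable i is c_i). -/
def divB (n : ℕ) : MvPolynomial ℕ ℚ :=
  ∑ P : n.Partition, (tau P.parts.toFinsupp) • MvPolynomial.monomial P.parts.toFinsupp (1 : ℚ)

/-- F ≡ G (mod p^t ℤ_p[c_1,…]) : every coefficient of F − G has v_p ≥ t -/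
def PCong (p t : ℕ) (F G : MvPolynomial ℕ ℚ) : Prop :=
  ∀ u : ℕ →₀ ℕ, ((t : ℤ) : WithTop ℤ) ≤ pval p (MvPolynomial.coeff u (F - G))

/-- `x ∈ 2 ^ t ℤ_(2)`. -/
def TwoDvd (t : ℕ) (x : ℚ) : Prop := ∃ a b : ℤ, Odd b ∧ (b : ℚ) * x = 2 ^ t * a

theorem TwoDvd.add {t : ℕ} {x y : ℚ} (hx : TwoDvd t x) (hy : TwoDvd t y) : TwoDvd t (x + y) := by
  obtain ⟨a, b, hb, h⟩ := hx
  obtain ⟨c, d, hd, h'⟩ := hy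
  refine ⟨a * d + c * b, b * d, hb.mul hd, ?_⟩
  push_cast
  linear_combination (d : ℚ) * h + (b : ℚ) * h'

theorem TwoDvd.neg {t : ℕ} {x : ℚ} (hx : TwoDvd t x) : TwoDvd t (-x) := by
  obtain ⟨a, b, hb, h⟩ := hx
  refine ⟨-a, b, hb, ?_⟩
  push_cast
  linear_combination -h

theorem TwoDvd.sub {t : ℕ} {x y : ℚ} (hx : TwoDvd t x) (hy : TwoDvd t y) : TwoDvd t (x - y) := by
  rw [sub_eq_add_neg]
  exact hx.add hy.neg

theorem TwoDvd.mul {s t : ℕ} {x y : ℚ} (hx : TwoDvd s x) (hy : TwoDvd t y) :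
    TwoDvd (s + t) (x * y) := by
  obtain ⟨a, b, hb, h⟩ := hx
  obtain ⟨c, d, hd, h'⟩ := hy
  refine ⟨a * c, b * d, hb.mul hd, ?_⟩
  push_cast
  rw [pow_add]
  linear_combination (d : ℚ) * y * h + (2 : ℚ) ^ s * a * h'

theorem TwoDvd.mono {s t : ℕ} {x : ℚ} (hst : s ≤ t) (hx : TwoDvd t x) : TwoDvd s x := by
  obtain ⟨a, b, hb, h⟩ := hx
  obtain ⟨r, rfl⟩ := Nat.exists_eq_add_of_le hst
  refine ⟨2 ^ r * a, b, hb, ?_⟩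
  rw [h]
  push_cast
  ring

theorem TwoDvd.of_dvd {t : ℕ} {a : ℤ} (h : 2 ^ t ∣ a) : TwoDvd t (a : ℚ) := by
  obtain ⟨c, rfl⟩ := h
  exact ⟨c, 1, odd_one, by push_cast; ring⟩

theorem TwoDvd.int (a : ℤ) : TwoDvd 0 (a : ℚ) := TwoDvd.of_dvd (by simp)

theorem TwoDvd.div_odd {t : ℕ} {x : ℚ} (hx : TwoDvd t x) {c : ℤ} (hc : Odd c) :
    TwoDvd t (x / c) := by
  obtain ⟨a, b, hb, h⟩ := hx
  have hc0 : (c : ℚ) ≠ 0 := by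
    intro h0
    rw [Int.cast_eq_zero.mp h0] at hc
    exact absurd hc (by decide)
  refine ⟨a, b * c, hb.mul hc, ?_⟩
  rw [← h]
  push_cast
  field_simp

theorem TwoDvd.of_mul_pow {s t : ℕ} {x : ℚ} (hx : TwoDvd (s + t) (2 ^ s * x)) : TwoDvd t x := by
  obtain ⟨a, b, hb, h⟩ := hx
  refine ⟨a, b, hb, ?_⟩
  have h2 : (2 : ℚ) ^ s ≠ 0 := by positivity
  apply mul_left_cancel₀ h2
  rw [pow_add] at h
  linear_combination h

theorem TwoDvd.pow_mul (t : ℕ) (a : ℤ) : TwoDvd t ((2 : ℚ) ^ t * a) :=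
  ⟨a, 1, odd_one, by push_cast; ring⟩

theorem Nat.exists_eq_two_pow_padicValNat_mul_odd {a : ℕ} (ha : a ≠ 0) :
    ∃ c, Odd c ∧ a = 2 ^ padicValNat 2 a * c := by
  obtain ⟨c, hc⟩ := (pow_padicValNat_dvd : 2 ^ padicValNat 2 a ∣ a)
  refine ⟨c, ?_, hc⟩
  by_contra h
  apply pow_succ_padicValNat_not_dvd (p := 2) ha
  rw [pow_succ]
  conv_rhs => rw [hc]
  exact mul_dvd_mul_left _ (even_iff_two_dvd.mp (Nat.not_odd_iff_even.mp h))

theorem TwoDvd.of_padicValNat {t a b : ℕ} (ha : a ≠ 0) (hb : b ≠ 0)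
    (h : t + padicValNat 2 b ≤ padicValNat 2 a) : TwoDvd t ((a : ℚ) / b) := by
  obtain ⟨c, hc, hac⟩ := Nat.exists_eq_two_pow_padicValNat_mul_odd ha
  obtain ⟨d, hd, hbd⟩ := Nat.exists_eq_two_pow_padicValNat_mul_odd hb
  obtain ⟨r, hr⟩ := Nat.exists_eq_add_of_le h
  refine ⟨2 ^ r * c, d, by exact_mod_cast hd, ?_⟩
  have hb0 : (b : ℚ) ≠ 0 := by exact_mod_cast hb
  rw [mul_div_assoc', div_eq_iff hb0]
  rw [hr] at hac
  have h1 : (a : ℚ) = 2 ^ (t + padicValNat 2 b + r) * c := by exact_mod_cast hac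
  have h2 : (b : ℚ) = 2 ^ (padicValNat 2 b) * d := by exact_mod_cast hbd
  rw [h1]
  push_cast
  conv_rhs => rw [h2]
  ring

theorem TwoDvd.le_pval {t : ℕ} {x : ℚ} (hx : TwoDvd t x) : ((t : ℤ) : WithTop ℤ) ≤ pval 2 x := by
  unfold pval
  split_ifs with h0
  · exact le_top
  obtain ⟨a, b, hb, h⟩ := hx
  have hb0 : (b : ℚ) ≠ 0 := by
    intro h0
    rw [Int.cast_eq_zero.mp h0] at hb
    exact absurd hb (by decide)
  have ha0 : (a : ℚ) ≠ 0 := by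
    rintro h'
    rw [h', mul_zero] at h
    exact (mul_ne_zero hb0 h0) h
  have h1 := congrArg (padicValRat 2) h
  rw [padicValRat.mul hb0 h0, padicValRat.mul (by positivity) ha0, padicValRat.pow,
    padicValRat.of_int, padicValRat.of_int] at h1
  have h2 : padicValInt 2 b = 0 := by
    apply padicValInt.eq_zero_of_not_dvd
    intro h
    exact absurd (even_iff_two_dvd.mpr h) (Int.not_even_iff_odd.mpr hb)
  have h3 : padicValRat 2 (2 : ℚ) = 1 := padicValRat.self (p := 2) one_lt_two
  rw [h2, h3] at h1
  push_cast at h1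
  have : (t : ℤ) ≤ padicValRat 2 x := by omega
  exact_mod_cast this

/-- The number `∏_{j < t} (2 j + 1) = (2 t - 1)!!`. -/
def oddProd (t : ℕ) : ℤ := ∏ j ∈ Finset.range t, (2 * (j : ℤ) + 1)

theorem oddProd_succ (t : ℕ) : oddProd (t + 1) = oddProd t * (2 * t + 1) :=
  Finset.prod_range_succ _ _

theorem odd_oddProd (t : ℕ) : Odd (oddProd t) := by
  induction t with
  | zero => simp [oddProd]
  | succ t ih => rw [oddProd_succ]; exact ih.mul (odd_two_mul_add_one _)

theorem oddProd_add (s t : ℕ) :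
    oddProd (s + t) = oddProd s * ∏ j ∈ Finset.range t, (2 * ((s : ℤ) + j) + 1) := by
  simp [oddProd, Finset.prod_range_add]

theorem oddProd_even_modEq (y : ℕ) : oddProd (2 * y) ≡ (-1) ^ y [ZMOD 4] := by
  induction y with
  | zero => simp [oddProd]
  | succ y ih =>
    rw [show 2 * (y + 1) = 2 * y + 1 + 1 by ring, oddProd_succ, oddProd_succ, mul_assoc, pow_succ]
    refine ih.mul ?_
    push_cast
    rw [Int.modEq_iff_dvd]
    exact ⟨-(4 * (y:ℤ) ^ 2 + 4 * y + 1), by ring⟩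

theorem oddProd_odd_modEq (y : ℕ) : oddProd (2 * y + 1) ≡ (-1) ^ y [ZMOD 4] := by
  rw [oddProd_succ]
  calc oddProd (2 * y) * (2 * ((2 * y : ℕ) : ℤ) + 1) ≡ (-1) ^ y * 1 [ZMOD 4] := by
        refine (oddProd_even_modEq y).mul ?_
        rw [Int.modEq_iff_dvd]
        exact ⟨-y, by push_cast; ring⟩
    _ = _ := by ring

theorem oddProd_two_pow (M : ℕ) (hM : 2 ≤ M) :
    (2 : ℤ) ^ (M + 2) ∣ oddProd (2 ^ M) - (1 + 2 ^ (M + 1)) := by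
  induction M, hM using Nat.le_induction with
  | base => decide
  | succ M hM ih =>
    have h1 : ∏ j ∈ Finset.range (2 ^ M), (2 * (((2 ^ M : ℕ) : ℤ) + j) + 1) ≡
        oddProd (2 ^ M) [ZMOD 2 ^ (M + 3)] := by
      calc ∏ j ∈ Finset.range (2 ^ M), (2 * (((2 ^ M : ℕ) : ℤ) + j) + 1)
          = ∏ j ∈ Finset.range (2 ^ M), (2 ^ (M + 2) - (2 * (j : ℤ) + 1)) := by
            rw [← Finset.prod_range_reflect]
            refine Finset.prod_congr rfl fun j hj => ?_
            have := Finset.mem_range.mp hj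
            rw [Nat.sub_sub, Nat.cast_sub (by omega)]
            push_cast
            ring
        _ ≡ ∏ j ∈ Finset.range (2 ^ M), ((2 ^ (M + 2) - 1) * (2 * (j : ℤ) + 1))
            [ZMOD 2 ^ (M + 3)] := by
            refine Int.ModEq.prod fun j _ => ?_
            rw [Int.modEq_iff_dvd]
            exact ⟨j, by ring⟩
        _ = ((2 ^ (M + 2) - 1) ^ 2) ^ (2 ^ (M - 1)) * oddProd (2 ^ M) := by
            rw [Finset.prod_mul_distrib, Finset.prod_const, Finset.card_range, ← pow_mul,
              ← pow_succ', Nat.sub_add_cancel (by omega)]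
            rfl
        _ ≡ 1 ^ (2 ^ (M - 1)) * oddProd (2 ^ M) [ZMOD 2 ^ (M + 3)] := by
            refine Int.ModEq.mul_right _ (Int.ModEq.pow _ ?_)
            rw [Int.modEq_iff_dvd]
            exact ⟨1 - 2 ^ (M + 1), by ring⟩
        _ = oddProd (2 ^ M) := by ring
    obtain ⟨c, hc⟩ := h1.symm.dvd
    obtain ⟨d, hd⟩ := ih
    rw [show 2 ^ (M + 1) = 2 ^ M + 2 ^ M by ring, oddProd_add, sub_eq_iff_eq_add.mp hc,
      sub_eq_iff_eq_add.mp hd]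
    obtain ⟨e, rfl⟩ := Nat.exists_eq_add_of_le hM
    exact ⟨2 ^ (e + 1) + 2 ^ (2 + e + 1) * d ^ 2 + d + 2 ^ (2 + e + 1) * d
      + c * (1 + 2 ^ (2 + e + 1) + 2 ^ (2 + e + 2) * d), by ring⟩

theorem oddProd_add_two_pow_modEq {N : ℕ} (hN : 2 ≤ N) (t : ℕ) :
    oddProd (t + 2 ^ N) ≡ oddProd t * (1 + 2 ^ (N + 1) * (1 + t)) [ZMOD 2 ^ (N + 2)] := by
  induction t with
  | zero =>
    have h := oddProd_two_pow N hN
    refine (Int.modEq_iff_dvd.mpr ?_).symm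
    simpa [oddProd] using h
  | succ t ih =>
    rw [show t + 1 + 2 ^ N = t + 2 ^ N + 1 by ring, oddProd_succ, oddProd_succ]
    refine (ih.mul_right _).trans ?_
    rw [Int.modEq_iff_dvd]
    exact ⟨oddProd t * (t - 2 ^ N * (1 + t)), by push_cast; ring⟩

theorem oddProd_add_modEq {N : ℕ} (hN : 2 ≤ N) (k t : ℕ) :
    oddProd (t + k * 2 ^ N) ≡ oddProd t * (1 + 2 ^ (N + 1) * k * (1 + t)) [ZMOD 2 ^ (N + 2)] := by
  induction k with
  | zero => simp
  | succ k ih =>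
    rw [show t + (k + 1) * 2 ^ N = t + k * 2 ^ N + 2 ^ N by ring]
    refine (oddProd_add_two_pow_modEq hN _).trans ((ih.mul_right _).trans ?_)
    obtain ⟨e, rfl⟩ := Nat.exists_eq_add_of_le hN
    rw [Int.modEq_iff_dvd]
    refine ⟨-oddProd t * (1 + 2 ^ (2 + e + 1) * k * (1 + t)) * (k * 2 ^ (1 + e))
      - oddProd t * 2 ^ (2 + e) * k * (1 + t) ^ 2, ?_⟩
    push_cast
    ring

theorem TwoDvd.oddProd_add_sub {N : ℕ} (hN : 2 ≤ N) (k t : ℕ) :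
    TwoDvd (N + 1) ((oddProd (t + k * 2 ^ N) : ℚ) - oddProd t) := by
  rw [← Int.cast_sub]
  apply TwoDvd.of_dvd
  obtain ⟨c, hc⟩ := (oddProd_add_modEq hN k t).symm.dvd
  exact ⟨2 * c + oddProd t * k * (1 + t), by linear_combination hc⟩

theorem two_pow_dvd_two_pow_log_mul_choose {M L h j : ℕ} (hL : 2 ^ M ∣ L) (hj : 1 ≤ j)
    (hjh : j ≤ h) : 2 ^ M ∣ 2 ^ Nat.log 2 h * L.choose j := by
  obtain ⟨j', rfl⟩ := Nat.exists_eq_succ_of_ne_zero (by omega : j ≠ 0)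
  rcases L with _ | L
  · simp
  have h1 : 2 ^ M ∣ (j' + 1) * (L + 1).choose (j' + 1) := by
    rw [mul_comm, ← Nat.add_one_mul_choose_eq]
    exact hL.mul_right _
  obtain ⟨c, hc, hjc⟩ := Nat.exists_eq_two_pow_padicValNat_mul_odd (Nat.succ_ne_zero j')
  have h2 : 2 ^ M ∣ 2 ^ padicValNat 2 (j' + 1) * (L + 1).choose (j' + 1) := by
    have : Nat.Coprime (2 ^ M) c := Nat.Coprime.pow_left _ (Nat.coprime_two_left.mpr hc)
    apply this.dvd_of_dvd_mul_left
    rw [← mul_assoc, mul_comm c]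
    rw [Nat.succ_eq_add_one] at hjc
    rwa [← hjc]
  refine h2.trans (mul_dvd_mul_right (pow_dvd_pow _ ?_) _)
  exact (padicValNat_le_nat_log _).trans (Nat.log_mono_right hjh)

theorem TwoDvd.two_pow_log_mul_choose_add_sub {M L : ℕ} (hL : 2 ^ M ∣ L) (y h : ℕ) :
    TwoDvd M (2 ^ Nat.log 2 h * (((y + L).choose h : ℚ) - (y.choose h : ℚ))) := by
  rw [add_comm y, Nat.add_choose_eq, Finset.Nat.sum_antidiagonal_eq_sum_range_succ_mk,
    Finset.sum_range_succ']
  simp only [Nat.choose_zero_right, one_mul, Nat.sub_zero]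
  push_cast
  rw [add_sub_cancel_right]
  have : (2 : ℤ) ^ M ∣ ∑ j ∈ Finset.range h,
      2 ^ Nat.log 2 h * ((L.choose (j + 1) : ℤ) * (y.choose (h - (j + 1)) : ℤ)) := by
    refine Finset.dvd_sum fun j hj => ?_
    have := two_pow_dvd_two_pow_log_mul_choose hL (by omega : 1 ≤ j + 1)
      (Nat.succ_le_of_lt (Finset.mem_range.mp hj))
    rw [← mul_assoc]
    exact Dvd.dvd.mul_right (by exact_mod_cast this) _
  have h2 := TwoDvd.of_dvd this
  push_cast at h2
  rwa [← Finset.mul_sum] at h2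

theorem wt_add (u v : ℕ →₀ ℕ) : wt (u + v) = wt u + wt v :=
  Finsupp.sum_add_index' (by simp) (by intros; ring)

theorem deg_add (u v : ℕ →₀ ℕ) : deg (u + v) = deg u + deg v :=
  Finsupp.sum_add_index' (by simp) (by intros; ring)

theorem wt_single (i a : ℕ) : wt (single i a) = i * a := by simp [wt]

theorem deg_single (i a : ℕ) : deg (single i a) = a := by simp [deg]

theorem gam_single (i a : ℕ) : gam (single i a) = (i + 1) ^ a * a.factorial :=
  Finsupp.prod_single_index (by simp)

theorem gam_single_add {i a : ℕ} {v : ℕ →₀ ℕ} (hv : v i = 0) :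
    gam (single i a + v) = (i + 1) ^ a * a.factorial * gam v := by
  rw [← gam_single]
  refine Finsupp.prod_add_index_of_disjoint ?_ _
  refine Finset.disjoint_of_subset_left Finsupp.support_single_subset ?_
  simpa using hv

theorem gam_ne_zero (v : ℕ →₀ ℕ) : gam v ≠ 0 :=
  Finset.prod_ne_zero_iff.mpr fun _ _ => by positivity

theorem deg_pos {v : ℕ →₀ ℕ} (hv : v ≠ 0) : 1 ≤ deg v := by
  obtain ⟨i, hi⟩ := Finsupp.support_nonempty_iff.mpr hv
  exact (Nat.one_le_iff_ne_zero.mpr (Finsupp.mem_support_iff.mp hi)).trans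
    (Finset.single_le_sum (f := fun j => v j) (fun _ _ => Nat.zero_le _) hi)

theorem factorial_eq_two_pow_mul_oddProd (T e : ℕ) (he : e < 2) :
    ((2 * T + e).factorial : ℤ) = 2 ^ T * T.factorial * oddProd (T + e) := by
  have h0 : ∀ T : ℕ, ((2 * T).factorial : ℤ) = 2 ^ T * T.factorial * oddProd T := by
    intro T
    induction T with
    | zero => simp [oddProd]
    | succ T ih =>
      rw [show 2 * (T + 1) = 2 * T + 1 + 1 by ring, Nat.factorial_succ, Nat.factorial_succ,
        Nat.factorial_succ, oddProd_succ]
      push_cast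
      rw [ih]
      ring
  interval_cases e
  · exact h0 T
  · rw [Nat.factorial_succ, oddProd_succ]
    push_cast
    rw [h0]
    ring

/-- The absolute value of `tau (single 1 S + v)` for `v 1 = 0`, `wt v + deg v = x + 2` and
`T = S + x / 2`. -/
def coreTau (v : ℕ →₀ ℕ) (x T : ℕ) : ℚ :=
  oddProd (T + x % 2) * (T.choose (x / 2) * ((2 ^ (x / 2) * (x / 2).factorial : ℕ) / (gam v : ℚ)))

theorem tau_single_one_add {v : ℕ →₀ ℕ} (hv : v 1 = 0) {x : ℕ} (hx : wt v + deg v = x + 2)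
    (S : ℕ) :
    tau (single 1 S + v) = (-1) ^ (S + deg v - 1) * coreTau v x (S + x / 2) := by
  have hg : (gam v : ℚ) ≠ 0 := by exact_mod_cast gam_ne_zero v
  have h1 : wt (single 1 S + v) + deg (single 1 S + v) - 2 = 2 * (S + x / 2) + x % 2 := by
    rw [wt_add, deg_add, wt_single, deg_single]
    omega
  have h2 := factorial_eq_two_pow_mul_oddProd (S + x / 2) (x % 2) (Nat.mod_lt _ two_pos)
  have h3 : ((2 * (S + x / 2) + x % 2).factorial : ℚ) =
      2 ^ (S + x / 2) * (S + x / 2).factorial * oddProd (S + x / 2 + x % 2) := by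
    exact_mod_cast h2
  have h4 := Nat.add_choose_mul_factorial_mul_factorial S (x / 2)
  have h5 : (((S + x / 2).choose (x / 2) : ℕ) : ℚ) * S.factorial * (x / 2).factorial =
      (S + x / 2).factorial := by
    exact_mod_cast h4
  rw [tau, h1, deg_add, deg_single, gam_single_add hv, h3, coreTau, ← h5]
  have h6 : (S.factorial : ℚ) ≠ 0 := by exact_mod_cast S.factorial_ne_zero
  push_cast
  rw [pow_add]
  field_simp

/-- The coefficient of `c ^ (single 1 S + v)` in `B̂_n / n - c_1 ^ l B̂_{n - l} / (n - l)`. -/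
def tauDiff (l S : ℕ) (v : ℕ →₀ ℕ) : ℚ :=
  tau (single 1 S + v) - if l ≤ S then tau (single 1 (S - l) + v) else 0

theorem tauDiff_eq_coreTau_sub {v : ℕ →₀ ℕ} (hv : v 1 = 0) (hv0 : v ≠ 0) {x : ℕ}
    (hx : wt v + deg v = x + 2) {l S t : ℕ} (hl : Even l) (ht : S + x / 2 = t + l) :
    tauDiff l S v = (-1) ^ (S + deg v - 1) * (coreTau v x (t + l) - coreTau v x t) := by
  have hd := deg_pos hv0
  rw [tauDiff, tau_single_one_add hv hx, ht, mul_sub]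
  congr 1
  split_ifs with h
  · rw [tau_single_one_add hv hx, show S - l + x / 2 = t by omega]
    congr 1
    rw [show S + deg v - 1 = S - l + deg v - 1 + l by omega, pow_add, hl.neg_one_pow, mul_one]
  · rw [coreTau, Nat.choose_eq_zero_of_lt (by omega : t < x / 2)]
    simp

theorem TwoDvd.sign_mul {t : ℕ} {x : ℚ} (hx : TwoDvd t x) (j : ℕ) : TwoDvd t ((-1) ^ j * x) := by
  rcases neg_one_pow_eq_or ℚ j with h | h <;> rw [h]
  · simpa using hx
  · simpa using hx.neg

theorem TwoDvd.factor {v : ℕ →₀ ℕ} {x e : ℕ}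
    (he : e + padicValNat 2 (gam v) ≤ padicValNat 2 x.factorial) :
    TwoDvd e ((2 ^ (x / 2) * (x / 2).factorial : ℕ) / (gam v : ℚ)) := by
  have h1 := (TwoDvd.of_padicValNat x.factorial_ne_zero (gam_ne_zero v) he).div_odd
    (odd_oddProd (x / 2 + x % 2))
  have h2 := factorial_eq_two_pow_mul_oddProd (x / 2) (x % 2) (Nat.mod_lt _ two_pos)
  rw [Nat.div_add_mod] at h2
  have h3 : (x.factorial : ℚ) = 2 ^ (x / 2) * (x / 2).factorial * oddProd (x / 2 + x % 2) := by
    exact_mod_cast h2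
  have h4 : (oddProd (x / 2 + x % 2) : ℚ) ≠ 0 := by
    have := odd_oddProd (x / 2 + x % 2)
    intro h
    rw [Int.cast_eq_zero.mp h] at this
    exact absurd this (by decide)
  convert h1 using 1
  rw [h3]
  push_cast
  field_simp

theorem TwoDvd.coreTau {v : ℕ →₀ ℕ} {x e : ℕ}
    (he : e + padicValNat 2 (gam v) ≤ padicValNat 2 x.factorial) (T : ℕ) :
    TwoDvd e (coreTau v x T) := by
  have := (TwoDvd.int (oddProd (T + x % 2))).mul
    ((TwoDvd.int (T.choose (x / 2))).mul (TwoDvd.factor he))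
  simpa [_root_.coreTau] using this

/-- Only the variation of the binomial coefficient matters. -/
theorem TwoDvd.coreTau_sub_of_factor {N : ℕ} (hN : 2 ≤ N) (k : ℕ) {v : ℕ →₀ ℕ} {x t : ℕ} {c : ℚ}
    (hq : TwoDvd 0 ((2 ^ (x / 2) * (x / 2).factorial : ℕ) / (gam v : ℚ)))
    (hc : TwoDvd (N + 1) (oddProd (t + x % 2) *
      ((((t + k * 2 ^ N).choose (x / 2) : ℚ) - t.choose (x / 2)) *
      ((2 ^ (x / 2) * (x / 2).factorial : ℕ) / (gam v : ℚ))) - c)) :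
    TwoDvd (N + 1) (_root_.coreTau v x (t + k * 2 ^ N) - _root_.coreTau v x t - c) := by
  have h1 := TwoDvd.oddProd_add_sub hN k (t + x % 2)
  have h2 := h1.mul ((TwoDvd.int ((t + k * 2 ^ N).choose (x / 2))).mul hq)
  convert h2.add hc using 1
  simp only [_root_.coreTau, show t + k * 2 ^ N + x % 2 = t + x % 2 + k * 2 ^ N by ring]
  push_cast
  ring

theorem TwoDvd.coreTau_sub {N : ℕ} (hN : 2 ≤ N) (k : ℕ) {v : ℕ →₀ ℕ} {x e : ℕ}
    (he : e + padicValNat 2 (gam v) ≤ padicValNat 2 x.factorial)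
    (hx : x ≤ 1 ∨ Nat.log 2 x ≤ e) (t : ℕ) :
    TwoDvd (N + 1) (_root_.coreTau v x (t + k * 2 ^ N) - _root_.coreTau v x t) := by
  have hq := TwoDvd.factor he
  have := TwoDvd.coreTau_sub_of_factor hN k (t := t) (c := 0) (hq.mono (Nat.zero_le _)) ?_
  · simpa using this
  rw [sub_zero]
  have key : TwoDvd (N + 1) ((((t + k * 2 ^ N).choose (x / 2) : ℚ) - t.choose (x / 2)) *
      ((2 ^ (x / 2) * (x / 2).factorial : ℕ) / (gam v : ℚ))) := by
    rcases Nat.lt_or_ge x 2 with h | h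
    · rw [Nat.div_eq_of_lt h]
      simpa using TwoDvd.of_dvd (dvd_zero _)
    · have hlog : Nat.log 2 x = Nat.log 2 (x / 2) + 1 := Nat.log_of_one_lt_of_le one_lt_two h
      have h1 := (TwoDvd.two_pow_log_mul_choose_add_sub (Nat.dvd_mul_left (2 ^ N) k) t (x / 2)).mul
        (hq.mono (by omega : Nat.log 2 (x / 2) + 1 ≤ e))
      rw [show N + (Nat.log 2 (x / 2) + 1) = Nat.log 2 (x / 2) + (N + 1) by ring, mul_assoc] at h1
      exact h1.of_mul_pow
  simpa using (TwoDvd.int (oddProd (t + x % 2))).mul key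

theorem padicValNat_two_factorial (n : ℕ) :
    padicValNat 2 n.factorial = n / 2 + padicValNat 2 (n / 2).factorial := by
  rw [← padicValNat_mul_div_factorial, padicValNat_factorial_mul, add_comm]

theorem le_padicValNat_two_factorial (n : ℕ) :
    n / 2 + n / 4 + n / 8 ≤ padicValNat 2 n.factorial := by
  rw [padicValNat_two_factorial n, padicValNat_two_factorial (n / 2),
    padicValNat_two_factorial (n / 2 / 2)]
  omega

theorem padicValNat_two_factorial_lt {n : ℕ} (hn : 1 ≤ n) : padicValNat 2 n.factorial + 1 ≤ n := by
  induction n using Nat.strong_induction_on with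
  | _ n ih =>
    rw [padicValNat_two_factorial]
    rcases Nat.lt_or_ge n 2 with h | h
    · obtain rfl : n = 1 := by omega
      simp
    · have := ih (n / 2) (by omega) (by omega)
      omega

theorem padicValNat_factorial_add_le (a b : ℕ) :
    padicValNat 2 a.factorial + padicValNat 2 b.factorial ≤ padicValNat 2 (a + b).factorial := by
  rw [← Nat.add_choose_mul_factorial_mul_factorial a b,
    padicValNat.mul (mul_ne_zero (Nat.choose_pos (by omega)).ne' a.factorial_ne_zero)
      b.factorial_ne_zero,
    padicValNat.mul (Nat.choose_pos (by omega)).ne' a.factorial_ne_zero]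
  omega

theorem padicValNat_gam_single_add {i a : ℕ} {v : ℕ →₀ ℕ} (hv : v i = 0) :
    padicValNat 2 (gam (single i a + v)) =
      padicValNat 2 (i + 1) * a + padicValNat 2 a.factorial + padicValNat 2 (gam v) := by
  rw [gam_single_add hv, padicValNat.mul (by positivity) (gam_ne_zero v),
    padicValNat.mul (by positivity) (by positivity), padicValNat.pow, mul_comm a]

theorem padicValNat_gam_single (i a : ℕ) :
    padicValNat 2 (gam (single i a)) =
      padicValNat 2 (i + 1) * a + padicValNat 2 a.factorial := by
  rw [gam_single, padicValNat.mul (by positivity) (by positivity), padicValNat.pow, mul_comm a]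

theorem two_mul_add_four_le_two_pow {e : ℕ} (he : 4 ≤ e) : 2 * e + 4 ≤ 2 ^ e := by
  induction e, he using Nat.le_induction with
  | base => norm_num
  | succ e he ih => rw [pow_succ]; omega

theorem two_mul_padicValNat_succ_add_one_le {i : ℕ} (hi : 2 ≤ i) (h3 : i ≠ 3) :
    2 * padicValNat 2 (i + 1) + 1 ≤ i ∧
      (i ≠ 2 → i ≠ 7 → 2 * padicValNat 2 (i + 1) + 3 ≤ i) := by
  have hle : 2 ^ padicValNat 2 (i + 1) ≤ i + 1 := Nat.le_of_dvd (by omega) pow_padicValNat_dvd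
  have hdvd : 2 ^ padicValNat 2 (i + 1) ∣ i + 1 := pow_padicValNat_dvd
  generalize padicValNat 2 (i + 1) = e at *
  rcases Nat.lt_or_ge e 4 with h | h
  · interval_cases e <;> omega
  · have := two_mul_add_four_le_two_pow h
    omega

theorem two_mul_padicValNat_gam_single_le {i k : ℕ} (hi : 2 ≤ i) (h3 : i ≠ 3) (hk : 1 ≤ k) :
    2 * (padicValNat 2 (i + 1) * k + padicValNat 2 k.factorial) + 2 ≤ (i + 1) * k ∧
      (¬ (i = 2 ∧ k = 1) → i ≠ 7 →
        2 * (padicValNat 2 (i + 1) * k + padicValNat 2 k.factorial) + 4 ≤ (i + 1) * k) := by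
  obtain ⟨h1, h2⟩ := two_mul_padicValNat_succ_add_one_le hi h3
  have hk' := padicValNat_two_factorial_lt hk
  constructor
  · nlinarith
  · intro hne h7
    rcases eq_or_ne i 2 with rfl | h
    · have : padicValNat 2 (2 + 1) = 0 := padicValNat.eq_zero_of_not_dvd (by norm_num)
      rw [this]
      omega
    · have := h2 h h7
      nlinarith

theorem two_mul_padicValNat_gam_add_two_le (r : ℕ →₀ ℕ) (h0 : r 0 = 0) (h1 : r 1 = 0)
    (h3 : r 3 = 0) (hr : r ≠ 0) : 2 * padicValNat 2 (gam r) + 2 ≤ wt r + deg r ∧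
      (2 * padicValNat 2 (gam r) + 4 ≤ wt r + deg r ∨ r = single 2 1 ∨
        ∃ j, 1 ≤ j ∧ r = single 7 j) := by
  induction r using Finsupp.induction with
  | zero => exact absurd rfl hr
  | single_add i k f hi hk ih =>
    have hfi : f i = 0 := by simpa using hi
    have hi0 : i ≠ 0 := by rintro rfl; simp [hk] at h0
    have hi1 : i ≠ 1 := by rintro rfl; simp [hk] at h1
    have hi3 : i ≠ 3 := by rintro rfl; simp [hk] at h3
    obtain ⟨b1, b2⟩ := two_mul_padicValNat_gam_single_le (k := k) (by omega : 2 ≤ i) hi3 (by omega)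
    rw [padicValNat_gam_single_add hfi, wt_add, deg_add, wt_single, deg_single]
    rw [add_mul, one_mul] at b1 b2
    rcases eq_or_ne f 0 with rfl | hf
    · have e1 : wt 0 = 0 := rfl
      have e2 : deg 0 = 0 := rfl
      have e3 : padicValNat 2 (gam 0) = 0 := by simp [gam]
      rw [e1, e2, e3, add_zero]
      refine ⟨by omega, ?_⟩
      by_cases h7 : i = 7
      · exact .inr (.inr ⟨k, by omega, by rw [h7, add_zero]⟩)
      by_cases h2 : i = 2 ∧ k = 1
      · exact .inr (.inl (by rw [h2.1, h2.2, add_zero]))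
      · exact .inl (by have := b2 h2 h7; omega)
    · have := (ih (by simpa [hi0] using h0) (by simpa [hi1] using h1) (by simpa [hi3] using h3)
        hf).1
      exact ⟨by omega, .inl (by omega)⟩

theorem Nat.log_two_le_div_four_add_one (x : ℕ) : Nat.log 2 x ≤ x / 4 + 1 := by
  rcases eq_or_ne x 0 with rfl | hx
  · simp
  have : Nat.log 2 x < x / 4 + 2 := by
    apply Nat.log_lt_of_lt_pow hx
    have := Nat.lt_two_pow_self (n := x / 4)
    rw [pow_add]
    omega
  omega

/-- The bounds on `v_2(tau r)` when `r` has no part `1` or `3`. -/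
theorem exists_le_padicValNat_tau_of_no_three (r : ℕ →₀ ℕ) (h0 : r 0 = 0) (h1 : r 1 = 0)
    (h3 : r 3 = 0) (hr : r ≠ 0) : ∃ x e, wt r + deg r = x + 2 ∧
      e + padicValNat 2 (gam r) ≤ padicValNat 2 x.factorial ∧
      (r = single 2 1 ∧ x = 1 ∧ e = 0 ∨ r = single 7 1 ∧ x = 6 ∧ e = 1 ∨
        2 ≤ x ∧ Nat.log 2 x ≤ e) ∧
      wt r ≤ 2 * e + 2 + x / 2 ∧ (x / 2 + 7 ≤ wt r → wt r ≤ 2 * e + x / 2) := by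
  have hd := deg_pos hr
  obtain ⟨b1, b2 | rfl | ⟨j, hj, rfl⟩⟩ := two_mul_padicValNat_gam_add_two_le r h0 h1 h3 hr
  · obtain ⟨x, hx⟩ := Nat.exists_eq_add_of_le (by omega : 2 ≤ wt r + deg r)
    have hv := le_padicValNat_two_factorial x
    have hlog := Nat.log_two_le_div_four_add_one x
    refine ⟨x, padicValNat 2 x.factorial - padicValNat 2 (gam r), ?_⟩
    exact ⟨by omega, by omega, .inr (.inr ⟨by omega, by omega⟩), by omega, by omega⟩
  · refine ⟨1, 0, ?_⟩
    rw [wt_single, deg_single, padicValNat_gam_single]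
    have : padicValNat 2 (2 + 1) = 0 := padicValNat.eq_zero_of_not_dvd (by norm_num)
    simp [this]
  · have e8 : padicValNat 2 (7 + 1) = 3 := by
      rw [show 7 + 1 = 2 ^ 3 by norm_num, padicValNat.prime_pow]
    have hjf := padicValNat_two_factorial_lt hj
    rw [wt_single, deg_single, padicValNat_gam_single, e8]
    have hv := le_padicValNat_two_factorial (8 * j - 2)
    refine ⟨8 * j - 2, 3 * j - 2, by omega, by omega, ?_, by omega, by omega⟩
    rcases eq_or_ne j 1 with rfl | hj1
    · exact .inr (.inl ⟨rfl, rfl, rfl⟩)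
    · refine .inr (.inr ⟨by omega, ?_⟩)
      have : Nat.log 2 (8 * j - 2) < 3 * j - 1 := by
        apply Nat.log_lt_of_lt_pow (by omega)
        obtain ⟨i, rfl⟩ := Nat.exists_eq_add_of_le (by omega : 2 ≤ j)
        have h2 := Nat.lt_two_pow_self (n := i)
        have h3 : 2 ^ i ≤ 2 ^ (3 * i) := Nat.pow_le_pow_right two_pos (by omega)
        rw [show 3 * (2 + i) - 1 = 5 + 3 * i by omega, pow_add]
        omega
      omega

theorem Nat.log_two_four_mul_add_le {x e : ℕ} (a : ℕ) (hx : 2 ≤ x) (h : Nat.log 2 x ≤ e) :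
    Nat.log 2 (4 * a + x) ≤ a + e := by
  have he : 1 ≤ e := (Nat.log_pos one_lt_two hx).trans_le h
  have h1 : x < 2 ^ (e + 1) :=
    (Nat.lt_pow_succ_log_self one_lt_two x).trans_le (Nat.pow_le_pow_right two_pos (by omega))
  have h2 : Nat.log 2 (4 * a + x) < a + (e + 1) := by
    apply Nat.log_lt_of_lt_pow (by omega)
    have h3 := Nat.lt_two_pow_self (n := a)
    have h4 : 2 ^ 2 ≤ 2 ^ (e + 1) := Nat.pow_le_pow_right two_pos (by omega)
    rw [pow_add]
    nlinarith
  omega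

/-- The bounds on `v_2(tau v)` when `v` has no part `1` and some part other than `3`. -/
theorem exists_le_padicValNat_tau (a : ℕ) (r : ℕ →₀ ℕ) (h0 : r 0 = 0) (h1 : r 1 = 0)
    (h3 : r 3 = 0) (hr : r ≠ 0) : ∃ x e, wt (single 3 a + r) + deg (single 3 a + r) = x + 2 ∧
      e + padicValNat 2 (gam (single 3 a + r)) ≤ padicValNat 2 x.factorial ∧
      (r = single 2 1 ∧ (a = 1 ∨ a = 2) ∨ r = single 7 1 ∧ a = 0 ∨ x ≤ 1 ∨ Nat.log 2 x ≤ e) ∧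
      (x / 2 + 8 ≤ wt (single 3 a + r) → wt (single 3 a + r) ≤ 2 * e + x / 2) := by
  obtain ⟨x, e, hx, he, hlog, hw, hw'⟩ := exists_le_padicValNat_tau_of_no_three r h0 h1 h3 hr
  have e4 : padicValNat 2 (3 + 1) = 2 := by
    rw [show 3 + 1 = 2 ^ 2 by norm_num, padicValNat.prime_pow]
  have hfac := padicValNat_factorial_add_le (4 * a) x
  have hfa : padicValNat 2 (4 * a).factorial = 3 * a + padicValNat 2 a.factorial := by
    rw [padicValNat_two_factorial, padicValNat_two_factorial (4 * a / 2),
      show 4 * a / 2 / 2 = a by omega]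
    omega
  rw [padicValNat_gam_single_add h3, wt_add, deg_add, wt_single, deg_single, e4]
  have hgen : (a + e) + (2 * a + padicValNat 2 a.factorial + padicValNat 2 (gam r)) ≤
    padicValNat 2 (4 * a + x).factorial := by omega
  have hfar : (4 * a + x) / 2 + 8 ≤ 3 * a + wt r →
      3 * a + wt r ≤ 2 * (a + e) + (4 * a + x) / 2 := by omega
  rcases hlog with ⟨rfl, rfl, rfl⟩ | ⟨rfl, rfl, rfl⟩ | ⟨h2, hlog⟩
  · refine ⟨4 * a + 1, a + 0, by omega, hgen, ?_, hfar⟩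
    rcases Nat.lt_or_ge a 3 with h | h
    · interval_cases a <;> simp
    · refine .inr (.inr (.inr ?_))
      obtain ⟨b, rfl⟩ := Nat.exists_eq_add_of_le h
      have : Nat.log 2 (4 * (3 + b) + 1) < 4 + b := by
        apply Nat.log_lt_of_lt_pow (by omega)
        have h2 := Nat.lt_two_pow_self (n := b)
        rw [pow_add]
        omega
      omega
  · rcases eq_or_ne a 1 with rfl | ha1
    · refine ⟨10, 3, by omega, ?_, .inr (.inr (.inr (by norm_num [Nat.log]))), by omega⟩
      have := le_padicValNat_two_factorial 10
      have e8 : padicValNat 2 (7 + 1) = 3 := by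
        rw [show 7 + 1 = 2 ^ 3 by norm_num, padicValNat.prime_pow]
      rw [padicValNat_gam_single, e8]
      simpa using this
    · refine ⟨4 * a + 6, a + 1, by omega, hgen, ?_, hfar⟩
      rcases eq_or_ne a 0 with rfl | ha0
      · simp
      · refine .inr (.inr (.inr ?_))
        obtain ⟨b, rfl⟩ := Nat.exists_eq_add_of_le (by omega : 2 ≤ a)
        have : Nat.log 2 (4 * (2 + b) + 6) < 4 + b := by
          apply Nat.log_lt_of_lt_pow (by omega)
          have h2 := Nat.lt_two_pow_self (n := b)
          rw [pow_add]
          omega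
        omega
  · exact ⟨4 * a + x, a + e, by omega, hgen,
      .inr (.inr (.inr (Nat.log_two_four_mul_add_le a h2 hlog))), hfar⟩

/-- `x (x - 2) (x - 4) ⋯` with `a` factors. -/
def stepProd (x : ℤ) (a : ℕ) : ℤ := ∏ i ∈ Finset.range a, (x - 2 * i)

theorem stepProd_succ (x : ℤ) (a : ℕ) : stepProd x (a + 1) = stepProd x a * (x - 2 * a) :=
  Finset.prod_range_succ _ _

theorem stepProd_zero (x : ℤ) : stepProd x 0 = 1 := rfl

theorem odd_stepProd {x : ℤ} (hx : Odd x) (a : ℕ) : Odd (stepProd x a) := by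
  induction a with
  | zero => exact odd_one
  | succ a ih => rw [stepProd_succ]; exact ih.mul (hx.sub_even (even_two_mul _))

theorem stepProd_modEq {M x y : ℤ} (h : x ≡ y [ZMOD M]) (a : ℕ) :
    stepProd x a ≡ stepProd y a [ZMOD M] :=
  Int.ModEq.prod fun _ _ => h.sub_right _

theorem cast_descFactorial_succ (n k : ℕ) :
    (n.descFactorial (k + 1) : ℤ) = (n - k) * n.descFactorial k := by
  rw [Nat.descFactorial_succ]
  rcases Nat.lt_or_ge n k with h | h
  · simp [Nat.descFactorial_of_lt h]
  · rw [Nat.cast_mul, Nat.cast_sub h]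

theorem cast_descFactorial_two_mul (y a : ℕ) :
    ((2 * y).descFactorial (2 * a) : ℤ) = 2 ^ a * y.descFactorial a * stepProd (2 * y - 1) a := by
  induction a with
  | zero => simp [stepProd_zero]
  | succ a ih =>
    rw [show 2 * (a + 1) = 2 * a + 1 + 1 by ring, cast_descFactorial_succ, cast_descFactorial_succ,
      ih, stepProd_succ, cast_descFactorial_succ]
    push_cast
    ring

theorem cast_descFactorial_two_mul_add_one (y a : ℕ) :
    ((2 * y + 1).descFactorial (2 * a + 1) : ℤ) =
      2 ^ a * y.descFactorial a * stepProd (2 * y + 1) (a + 1) := by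
  induction a with
  | zero => simp [stepProd_zero, stepProd_succ]
  | succ a ih =>
    rw [show 2 * (a + 1) + 1 = 2 * a + 1 + 1 + 1 by ring, cast_descFactorial_succ,
      cast_descFactorial_succ, ih, stepProd_succ _ (a + 1), cast_descFactorial_succ]
    push_cast
    ring

theorem coreTau_single_three_even (c y : ℕ) :
    coreTau (single 3 (2 * c + 2)) (8 * c + 6) (2 * y) =
      (oddProd (2 * y) * stepProd (2 * y - 1) (2 * c + 1) : ℤ) *
        (2 ^ (2 * c + 1) * y.choose (2 * c + 2)) := by
  have h1 := cast_descFactorial_succ (2 * y) (2 * (2 * c + 1))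
  rw [cast_descFactorial_two_mul] at h1
  have h2 := cast_descFactorial_succ y (2 * c + 1)
  rw [Nat.descFactorial_eq_factorial_mul_choose] at h1 h2
  have h3 : ((2 * (2 * c + 1) + 1).factorial * (2 * y).choose (2 * (2 * c + 1) + 1) : ℚ) =
      2 ^ (2 * c + 2) * ((2 * c + 2).factorial * y.choose (2 * c + 2)) *
        stepProd (2 * y - 1) (2 * c + 1) := by
    have : (((2 * (2 * c + 1) + 1).factorial * (2 * y).choose (2 * (2 * c + 1) + 1) : ℕ) : ℤ) =
      2 ^ (2 * c + 2) * (((2 * c + 2).factorial * y.choose (2 * c + 2) : ℕ) : ℤ) *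
        stepProd (2 * y - 1) (2 * c + 1) := by
      rw [h1, h2]
      push_cast
      ring
    exact_mod_cast this
  have h4 : ((2 * c + 2).factorial : ℚ) ≠ 0 := by exact_mod_cast Nat.factorial_ne_zero _
  rw [coreTau, gam_single, show (8 * c + 6) / 2 = 2 * (2 * c + 1) + 1 by omega,
    show (8 * c + 6) % 2 = 0 by omega, add_zero]
  push_cast
  rw [mul_assoc (oddProd (2 * y) : ℚ)]
  congr 1
  rw [mul_div_assoc', div_eq_iff (by positivity)]
  calc _ = 2 ^ (2 * (2 * c + 1) + 1) *
        ((2 * (2 * c + 1) + 1).factorial * (2 * y).choose (2 * (2 * c + 1) + 1) : ℚ) := by ring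
    _ = _ := by
      rw [h3, show (4 : ℚ) ^ (2 * c + 2) = 2 ^ (2 * (2 * c + 2)) by rw [pow_mul]; norm_num]
      ring

theorem coreTau_single_three_odd (c y : ℕ) :
    coreTau (single 3 (2 * c + 3)) (8 * c + 10) (2 * y + 1) =
      (oddProd (2 * y + 1) * stepProd (2 * y + 1) (2 * c + 3) : ℤ) *
        (2 ^ (2 * c + 1) * y.choose (2 * c + 2)) / (2 * c + 3 : ℤ) := by
  have h1 := cast_descFactorial_two_mul_add_one y (2 * c + 2)
  rw [Nat.descFactorial_eq_factorial_mul_choose, Nat.descFactorial_eq_factorial_mul_choose] at h1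
  have h3 : ((2 * (2 * c + 2) + 1).factorial * (2 * y + 1).choose (2 * (2 * c + 2) + 1) : ℚ) =
      2 ^ (2 * c + 2) * ((2 * c + 2).factorial * y.choose (2 * c + 2)) *
        stepProd (2 * y + 1) (2 * c + 3) := by
    exact_mod_cast h1
  have h4 : ((2 * c + 2).factorial : ℚ) ≠ 0 := by exact_mod_cast Nat.factorial_ne_zero _
  rw [coreTau, gam_single, show (8 * c + 10) / 2 = 2 * (2 * c + 2) + 1 by omega,
    show (8 * c + 10) % 2 = 0 by omega, add_zero, Nat.factorial_succ (2 * c + 2)]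
  push_cast
  rw [mul_assoc (oddProd (2 * y + 1) : ℚ), mul_div_assoc (oddProd (2 * y + 1) : ℚ)]
  congr 1
  rw [mul_div_assoc', div_eq_div_iff (by positivity) (by positivity)]
  calc _ = 2 ^ (2 * (2 * c + 2) + 1) * (2 * c + 3) * ((2 * (2 * c + 2) + 1).factorial *
        (2 * y + 1).choose (2 * (2 * c + 2) + 1) : ℚ) := by ring
    _ = _ := by
      rw [h3, show (4 : ℚ) ^ (2 * c + 3) = 2 ^ (2 * (2 * c + 3)) by rw [pow_mul]; norm_num]
      ring

theorem oddProd_add_modEq_two_pow {N : ℕ} (hN : 2 ≤ N) (k t : ℕ) :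
    oddProd (t + k * 2 ^ N) ≡ oddProd t [ZMOD 2 ^ N] := by
  refine ((oddProd_add_modEq hN k t).of_dvd (pow_dvd_pow 2 (by omega))).trans ?_
  rw [Int.modEq_iff_dvd]
  exact ⟨-oddProd t * (2 * k * (1 + t)), by ring⟩

theorem TwoDvd.oddProd_mul_stepProd_sub {N : ℕ} (hN : 2 ≤ N) (k t a : ℕ) (x : ℤ) :
    TwoDvd N (((oddProd (t + k * 2 ^ N) * stepProd (x + k * 2 ^ N) a : ℤ) : ℚ) -
      (oddProd t * stepProd x a : ℤ)) := by
  rw [← Int.cast_sub]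
  apply TwoDvd.of_dvd
  refine Int.ModEq.dvd (Int.ModEq.symm ?_)
  refine (oddProd_add_modEq_two_pow hN k t).mul (stepProd_modEq ?_ a)
  rw [Int.modEq_iff_dvd]
  exact ⟨-k, by ring⟩

theorem TwoDvd.coreTau_three_even_sub {N : ℕ} (hN : 2 ≤ N) (k c y : ℕ) {z : ℚ}
    (h : TwoDvd (N + 1) ((oddProd (2 * y) * stepProd (2 * y - 1) (2 * c + 1) : ℤ) *
      (2 ^ (2 * c + 1) * (((y + k * 2 ^ (N - 1)).choose (2 * c + 2) : ℚ) -
        y.choose (2 * c + 2))) - z)) :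
    TwoDvd (N + 1) (_root_.coreTau (single 3 (2 * c + 2)) (8 * c + 6) (2 * y + k * 2 ^ N) -
      _root_.coreTau (single 3 (2 * c + 2)) (8 * c + 6) (2 * y) - z) := by
  have e : 2 * y + k * 2 ^ N = 2 * (y + k * 2 ^ (N - 1)) := by
    obtain ⟨M, rfl⟩ := Nat.exists_eq_add_of_le' hN
    simp only [Nat.add_succ_sub_one]
    ring
  have e' : 2 * (y : ℤ) - 1 + k * 2 ^ N = 2 * ((y + k * 2 ^ (N - 1) : ℕ) : ℤ) - 1 := by
    have : (2 * y + k * 2 ^ N : ℤ) = 2 * ((y + k * 2 ^ (N - 1) : ℕ) : ℤ) := by exact_mod_cast e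
    linear_combination this
  have h1 := (TwoDvd.oddProd_mul_stepProd_sub hN k (2 * y) (2 * c + 1) (2 * y - 1)).mul
    (TwoDvd.pow_mul (2 * c + 1) ((y + k * 2 ^ (N - 1)).choose (2 * c + 2)))
  rw [e, e'] at h1
  rw [e, coreTau_single_three_even, coreTau_single_three_even]
  convert (h1.mono (by omega : N + 1 ≤ N + (2 * c + 1))).add h using 1
  push_cast
  ring

theorem TwoDvd.coreTau_three_odd_sub {N : ℕ} (hN : 2 ≤ N) (k c y : ℕ) {z : ℚ}
    (h : TwoDvd (N + 1) ((oddProd (2 * y + 1) * stepProd (2 * y + 1) (2 * c + 3) : ℤ) *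
      (2 ^ (2 * c + 1) * (((y + k * 2 ^ (N - 1)).choose (2 * c + 2) : ℚ) -
        y.choose (2 * c + 2))) / (2 * c + 3 : ℤ) - z)) :
    TwoDvd (N + 1) (_root_.coreTau (single 3 (2 * c + 3)) (8 * c + 10) (2 * y + 1 + k * 2 ^ N) -
      _root_.coreTau (single 3 (2 * c + 3)) (8 * c + 10) (2 * y + 1) - z) := by
  have e0 : 2 * y + k * 2 ^ N = 2 * (y + k * 2 ^ (N - 1)) := by
    obtain ⟨M, rfl⟩ := Nat.exists_eq_add_of_le' hN
    simp only [Nat.add_succ_sub_one]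
    ring
  have e : 2 * y + 1 + k * 2 ^ N = 2 * (y + k * 2 ^ (N - 1)) + 1 := by omega
  have e' : 2 * (y : ℤ) + 1 + k * 2 ^ N = 2 * ((y + k * 2 ^ (N - 1) : ℕ) : ℤ) + 1 := by
    exact_mod_cast e
  have h1 := ((TwoDvd.oddProd_mul_stepProd_sub hN k (2 * y + 1) (2 * c + 3) (2 * y + 1)).mul
    (TwoDvd.pow_mul (2 * c + 1) ((y + k * 2 ^ (N - 1)).choose (2 * c + 2)))).div_odd
    (show Odd (2 * c + 3 : ℤ) from ⟨c + 1, by ring⟩)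
  rw [e, e'] at h1
  rw [e, coreTau_single_three_odd, coreTau_single_three_odd]
  convert (h1.mono (by omega : N + 1 ≤ N + (2 * c + 1))).add h using 1
  push_cast
  ring

theorem TwoDvd.two_pow_mul_choose_sub {N : ℕ} (hN : 2 ≤ N) (k y : ℕ) {c : ℕ} (hc : 2 ≤ c) :
    TwoDvd (N + 1) (2 ^ (2 * c + 1) * (((y + k * 2 ^ (N - 1)).choose (2 * c + 2) : ℚ) -
        y.choose (2 * c + 2))) := by
  have h1 := TwoDvd.two_pow_log_mul_choose_add_sub (Nat.dvd_mul_left (2 ^ (N - 1)) k) y (2 * c + 2)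
  have hlog : Nat.log 2 (2 * c + 2) ≤ 2 * c - 1 := by
    have : Nat.log 2 (2 * c + 2) < 2 * c := by
      apply Nat.log_lt_of_lt_pow (by omega)
      obtain ⟨d, rfl⟩ := Nat.exists_eq_add_of_le hc
      have h2 := Nat.lt_two_pow_self (n := 2 * d)
      rw [show 2 * (2 + d) = 4 + 2 * d by ring, pow_add]
      omega
    omega
  have h2 := (TwoDvd.pow_mul (2 * c + 1 - Nat.log 2 (2 * c + 2)) 1).mul h1
  convert h2.mono (by omega : N + 1 ≤ 2 * c + 1 - Nat.log 2 (2 * c + 2) + (N - 1)) using 1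
  rw [Int.cast_one, mul_one, ← mul_assoc, ← pow_add, Nat.sub_add_cancel (by omega)]

theorem cast_choose_three (y : ℕ) : (6 * y.choose 3 : ℚ) = y * (y - 1) * (y - 2) := by
  have h : ((Nat.factorial 3 * y.choose 3 : ℕ) : ℤ) = y * (y - 1) * (y - 2) := by
    rw [← Nat.descFactorial_eq_factorial_mul_choose, cast_descFactorial_succ,
      cast_descFactorial_succ, Nat.descFactorial_one]
    push_cast
    ring
  simp only [Nat.factorial] at h
  exact_mod_cast h

theorem cast_choose_four (y : ℕ) : (24 * y.choose 4 : ℚ) = y * (y - 1) * (y - 2) * (y - 3) := by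
  have h : ((Nat.factorial 4 * y.choose 4 : ℕ) : ℤ) = y * (y - 1) * (y - 2) * (y - 3) := by
    rw [← Nat.descFactorial_eq_factorial_mul_choose, cast_descFactorial_succ,
      cast_descFactorial_succ, cast_descFactorial_succ, Nat.descFactorial_one]
    push_cast
    ring
  simp only [Nat.factorial] at h
  exact_mod_cast h

theorem two_mul_choose_two_add_sub (y L : ℕ) :
    2 * (((y + L).choose 2 : ℚ) - y.choose 2) = L ^ 2 + L * (2 * y - 1) := by
  rw [Nat.cast_choose_two, Nat.cast_choose_two]
  push_cast
  ring

theorem TwoDvd.eight_mul_choose_four_sub {N : ℕ} (hN : 3 ≤ N) (k y : ℕ) :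
    TwoDvd (N + 1) (8 * (((y + k * 2 ^ (N - 1)).choose 4 : ℚ) - y.choose 4) - k * 2 ^ N) := by
  obtain ⟨P, rfl⟩ := Nat.exists_eq_add_of_le' hN
  have h1 := cast_choose_four (y + k * 2 ^ (P + 2))
  have h2 := cast_choose_four y
  obtain ⟨c, hc⟩ := Int.even_mul_pred_self y
  qify at hc
  refine ⟨k * (y ^ 3 + y - 3 - 9 * c) + 2 ^ P * k ^ 2 * (6 * y ^ 2 - 18 * y + 11 +
    (4 * y - 6) * (k * 2 ^ (P + 2)) + (k * 2 ^ (P + 2)) ^ 2), 3, by decide, ?_⟩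
  simp only [Nat.add_succ_sub_one] at *
  push_cast at *
  rw [show ∀ a b c : ℚ, 3 * (8 * (a - b) - c) = 24 * a - 24 * b - 3 * c by intros; ring, h1, h2]
  linear_combination -9 * (k * 2 ^ (P + 3)) * hc

theorem exists_oddProd_even_eq (y : ℕ) : ∃ q : ℤ, oddProd (2 * y) = (-1) ^ y + 4 * q := by
  obtain ⟨q, hq⟩ := (oddProd_even_modEq y).symm.dvd
  exact ⟨q, by linear_combination hq⟩

theorem exists_oddProd_odd_eq (y : ℕ) : ∃ q : ℤ, oddProd (2 * y + 1) = (-1) ^ y + 4 * q := by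
  obtain ⟨q, hq⟩ := (oddProd_odd_modEq y).symm.dvd
  exact ⟨q, by linear_combination hq⟩

theorem TwoDvd.coreTau_single_three_two_sub {N : ℕ} (hN : 3 ≤ N) (k y : ℕ) :
    TwoDvd (N + 1) (_root_.coreTau (single 3 2) 6 (2 * y + k * 2 ^ N) -
      _root_.coreTau (single 3 2) 6 (2 * y) - (-1) ^ y * (k * 2 ^ N) / 2) := by
  refine TwoDvd.coreTau_three_even_sub (by omega) k 0 y ?_
  rw [show 2 ^ (2 * 0 + 1) = (2 : ℚ) by norm_num, show 2 * 0 + 2 = 2 from rfl,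
    two_mul_choose_two_add_sub]
  obtain ⟨P, rfl⟩ := Nat.exists_eq_add_of_le' hN
  obtain ⟨q, hq⟩ := exists_oddProd_even_eq y
  refine ⟨oddProd (2 * y) * (2 * y - 1) * (k ^ 2 * 2 ^ P) +
    k * (q * (2 * y - 1) ^ 2 + (-1) ^ y * (y ^ 2 - y)), 1, odd_one, ?_⟩
  simp only [Nat.add_succ_sub_one, stepProd, Finset.prod_range_succ, hq]
  push_cast
  ring

theorem TwoDvd.coreTau_single_three_three_sub {N : ℕ} (hN : 3 ≤ N) (k y : ℕ) :
    TwoDvd (N + 1) (_root_.coreTau (single 3 3) 10 (2 * y + 1 + k * 2 ^ N) -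
      _root_.coreTau (single 3 3) 10 (2 * y + 1) - (-1) ^ (y + 1) * (k * 2 ^ N) / 2) := by
  refine TwoDvd.coreTau_three_odd_sub (by omega) k 0 y ?_
  rw [show 2 ^ (2 * 0 + 1) = (2 : ℚ) by norm_num, show 2 * 0 + 2 = 2 from rfl,
    two_mul_choose_two_add_sub]
  obtain ⟨P, rfl⟩ := Nat.exists_eq_add_of_le' hN
  obtain ⟨q, hq⟩ := exists_oddProd_odd_eq y
  refine ⟨oddProd (2 * y + 1) * ((2 * y + 1) * (2 * y - 1) * (2 * y - 3)) * (k ^ 2 * 2 ^ P) +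
    k * (q * (2 * y + 1) * (2 * y - 1) ^ 2 * (2 * y - 3) +
      (-1) ^ y * ((y ^ 2 - y) * (4 * y ^ 2 - 4 * y - 2))), 3, by decide, ?_⟩
  simp only [Nat.add_succ_sub_one, stepProd, Finset.prod_range_succ, hq]
  push_cast
  ring

theorem TwoDvd.odd_mul_two_pow_sub {N : ℕ} (k : ℕ) {a b : ℤ} (ha : Odd a) (hb : Odd b) {x : ℚ}
    (hx : TwoDvd (N + 1) (x - k * 2 ^ N)) : TwoDvd (N + 1) (a * x / b - k * 2 ^ N) := by
  have hb0 : (b : ℚ) ≠ 0 := by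
    rintro h
    rw [Int.cast_eq_zero.mp h] at hb
    exact absurd hb (by decide)
  obtain ⟨c, hc⟩ := ha.sub_odd hb
  have h := (((TwoDvd.int a).mul hx).add
    (TwoDvd.of_dvd (t := 0 + (N + 1)) (a := (a - b) * (k * 2 ^ N))
      ⟨c * k, by rw [hc]; ring⟩)).div_odd hb
  rw [zero_add] at h
  convert h using 1
  push_cast
  field_simp
  ring

theorem TwoDvd.coreTau_single_three_four_sub {N : ℕ} (hN : 3 ≤ N) (k y : ℕ) :
    TwoDvd (N + 1) (_root_.coreTau (single 3 4) 14 (2 * y + k * 2 ^ N) -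
      _root_.coreTau (single 3 4) 14 (2 * y) - k * 2 ^ N) := by
  refine TwoDvd.coreTau_three_even_sub (by omega) k 1 y ?_
  have h := TwoDvd.odd_mul_two_pow_sub k ((odd_oddProd (2 * y)).mul
    (odd_stepProd ⟨y - 1, by ring⟩ (2 * 1 + 1) : Odd (stepProd (2 * y - 1) (2 * 1 + 1)))) odd_one
    (TwoDvd.eight_mul_choose_four_sub hN k y)
  convert h using 1
  norm_num

theorem TwoDvd.coreTau_single_three_five_sub {N : ℕ} (hN : 3 ≤ N) (k y : ℕ) :
    TwoDvd (N + 1) (_root_.coreTau (single 3 5) 18 (2 * y + 1 + k * 2 ^ N) -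
      _root_.coreTau (single 3 5) 18 (2 * y + 1) - k * 2 ^ N) := by
  refine TwoDvd.coreTau_three_odd_sub (by omega) k 1 y ?_
  have h := TwoDvd.odd_mul_two_pow_sub k ((odd_oddProd (2 * y + 1)).mul
    (odd_stepProd ⟨y, by ring⟩ (2 * 1 + 3) : Odd (stepProd (2 * y + 1) (2 * 1 + 3))))
    (by decide : Odd (5 : ℤ)) (TwoDvd.eight_mul_choose_four_sub hN k y)
  convert h using 1
  norm_num

theorem TwoDvd.coreTau_three_even_sub_zero {N : ℕ} (hN : 3 ≤ N) (k y : ℕ) {c : ℕ} (hc : 2 ≤ c) :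
    TwoDvd (N + 1) (_root_.coreTau (single 3 (2 * c + 2)) (8 * c + 6) (2 * y + k * 2 ^ N) -
      _root_.coreTau (single 3 (2 * c + 2)) (8 * c + 6) (2 * y) - 0) := by
  refine TwoDvd.coreTau_three_even_sub (by omega) k c y ?_
  have h := (TwoDvd.int (oddProd (2 * y) * stepProd (2 * y - 1) (2 * c + 1))).mul
    (TwoDvd.two_pow_mul_choose_sub (by omega : 2 ≤ N) k y hc)
  rwa [zero_add, ← sub_zero (_ * _)] at h

theorem TwoDvd.coreTau_three_odd_sub_zero {N : ℕ} (hN : 3 ≤ N) (k y : ℕ) {c : ℕ} (hc : 2 ≤ c) :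
    TwoDvd (N + 1) (_root_.coreTau (single 3 (2 * c + 3)) (8 * c + 10) (2 * y + 1 + k * 2 ^ N) -
      _root_.coreTau (single 3 (2 * c + 3)) (8 * c + 10) (2 * y + 1) - 0) := by
  refine TwoDvd.coreTau_three_odd_sub (by omega) k c y ?_
  have h := ((TwoDvd.int (oddProd (2 * y + 1) * stepProd (2 * y + 1) (2 * c + 3))).mul
    (TwoDvd.two_pow_mul_choose_sub (by omega : 2 ≤ N) k y hc)).div_odd
    (show Odd (2 * c + 3 : ℤ) from ⟨c + 1, by ring⟩)
  rwa [zero_add, ← sub_zero (_ / _)] at h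

theorem coreTau_single_three_one (T : ℕ) :
    coreTau (single 3 1) 2 T = oddProd T * T / 2 := by
  rw [coreTau, gam_single]
  norm_num
  ring

theorem TwoDvd.coreTau_single_three_one_sub {N : ℕ} (hN : 3 ≤ N) (k y : ℕ) :
    TwoDvd (N + 1) (_root_.coreTau (single 3 1) 2 (2 * y + 1 + k * 2 ^ N) -
      _root_.coreTau (single 3 1) 2 (2 * y + 1) - (-1) ^ y * (k * 2 ^ N) / 2) := by
  obtain ⟨r, hr⟩ := (oddProd_add_modEq (by omega : 2 ≤ N) k (2 * y + 1)).symm.dvd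
  obtain ⟨q, hq⟩ := exists_oddProd_odd_eq y
  obtain ⟨P, rfl⟩ := Nat.exists_eq_add_of_le' hN
  have hr' : oddProd (2 * y + 1 + k * 2 ^ (P + 3)) = oddProd (2 * y + 1) +
      2 ^ (P + 5) * (r + oddProd (2 * y + 1) * k * (1 + y)) := by
    push_cast at hr
    linear_combination hr
  rw [coreTau_single_three_one, coreTau_single_three_one, hr', hq]
  refine ⟨(r + ((-1) ^ y + 4 * q) * k * (1 + y)) * (2 * y + 1 + k * 2 ^ (P + 3)) + q * k,
    1, odd_one, ?_⟩
  push_cast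
  ring

theorem tau_single_one_odd {n : ℕ} (hn : Odd n) : tau (single 1 n) = oddProd (n - 1) / (2 * n) := by
  obtain ⟨j, rfl⟩ := hn
  have h := factorial_eq_two_pow_mul_oddProd (2 * j) 0 two_pos
  have h' : ((2 * (2 * j)).factorial : ℚ) = 2 ^ (2 * j) * (2 * j).factorial * oddProd (2 * j) := by
    exact_mod_cast h
  have h2 : ((2 * j).factorial : ℚ) ≠ 0 := by exact_mod_cast Nat.factorial_ne_zero _
  have h3 : (2 * j + 1 : ℚ) ≠ 0 := by positivity
  rw [tau, gam_single, deg_single, wt_single,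
    show 1 * (2 * j + 1) + (2 * j + 1) - 2 = 2 * (2 * j) by omega, h', Nat.factorial_succ,
    Nat.add_sub_cancel, pow_mul (-1 : ℚ)]
  push_cast
  norm_num
  field_simp
  ring

theorem TwoDvd.tauDiff_zero {N : ℕ} (hN : 3 ≤ N) (k : ℕ) {m : ℕ} (hm : Odd m) :
    TwoDvd (N + 1) (tauDiff (k * 2 ^ N) (m + k * 2 ^ N) 0 +
      (-1) ^ ((m + 1) / 2) * (k * 2 ^ N) / 2) := by
  obtain ⟨P, rfl⟩ := Nat.exists_eq_add_of_le' hN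
  have hl : Even (k * 2 ^ (P + 3)) := ⟨k * 2 ^ (P + 2), by ring⟩
  rw [tauDiff, if_pos (by omega), add_zero, add_zero, Nat.add_sub_cancel,
    tau_single_one_odd hm, tau_single_one_odd (hm.add_even hl)]
  obtain ⟨y, rfl⟩ := hm
  obtain ⟨r, hr⟩ := (oddProd_add_modEq (by omega : 2 ≤ P + 3) k (2 * y)).symm.dvd
  obtain ⟨q, hq⟩ := exists_oddProd_even_eq y
  have hr' : oddProd (2 * y + k * 2 ^ (P + 3)) = oddProd (2 * y) +
      2 ^ (P + 4) * oddProd (2 * y) * k * (1 + 2 * y) + 2 ^ (P + 5) * r := by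
    push_cast at hr
    linear_combination hr
  rw [show 2 * y + 1 + k * 2 ^ (P + 3) - 1 = 2 * y + k * 2 ^ (P + 3) by omega,
    Nat.add_sub_cancel, show (2 * y + 1 + 1) / 2 = y + 1 by omega, hr', hq]
  have h1 : (2 * y + 1 : ℚ) ≠ 0 := by positivity
  have h2 : (2 * y + 1 + k * 2 ^ (P + 3) : ℚ) ≠ 0 := by positivity
  refine ⟨k * ((-1) ^ y * (y ^ 2 + y - (2 * y + 1) * (2 ^ (P + 1) * k)) +
    q * (2 * (2 * y + 1) ^ 2 - 1)) + (2 * y + 1) * r, (2 * y + 1) * (2 * y + 1 + k * 2 ^ (P + 3)),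
    Odd.mul ⟨y, rfl⟩ ⟨y + k * 2 ^ (P + 2), by ring⟩, ?_⟩
  push_cast
  field_simp
  ring

theorem TwoDvd.coreTau_three_add_two_sub {N : ℕ} (hN : 3 ≤ N) (k t : ℕ) :
    TwoDvd (N + 1) (_root_.coreTau (single 3 1 + single 2 1) 5 (t + k * 2 ^ N) -
      _root_.coreTau (single 3 1 + single 2 1) 5 t - k * 2 ^ N) := by
  have hq : (2 ^ (5 / 2) * (5 / 2).factorial : ℕ) / (gam (single 3 1 + single 2 1) : ℚ) =
      2 / 3 := by
    rw [gam_single_add (by simp), gam_single]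
    norm_num [Nat.factorial]
  apply TwoDvd.coreTau_sub_of_factor (by omega)
  · rw [hq]
    exact ⟨2, 3, by decide, by norm_num⟩
  rw [hq]
  obtain ⟨P, rfl⟩ := Nat.exists_eq_add_of_le' hN
  obtain ⟨q, hq⟩ := odd_oddProd (t + 5 % 2)
  have h := two_mul_choose_two_add_sub t (k * 2 ^ (P + 3))
  refine ⟨k * (q * (2 * t - 1) + t - 2 + (2 * q + 1) * (2 ^ (P + 2) * k)), 3, by decide, ?_⟩
  rw [hq]
  push_cast at h ⊢
  linear_combination (2 * q + 1 : ℚ) * h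

theorem TwoDvd.coreTau_three_three_add_two_sub {N : ℕ} (hN : 3 ≤ N) (k t : ℕ) :
    TwoDvd (N + 1) (_root_.coreTau (single 3 2 + single 2 1) 9 (t + k * 2 ^ N) -
      _root_.coreTau (single 3 2 + single 2 1) 9 t - k * 2 ^ N) := by
  have hq : (2 ^ (9 / 2) * (9 / 2).factorial : ℕ) / (gam (single 3 2 + single 2 1) : ℚ) = 4 := by
    rw [gam_single_add (by simp), gam_single]
    norm_num [Nat.factorial]
  apply TwoDvd.coreTau_sub_of_factor (by omega)
  · rw [hq]
    exact TwoDvd.int 4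
  rw [hq]
  obtain ⟨P, rfl⟩ := Nat.exists_eq_add_of_le' hN
  obtain ⟨q, hq⟩ := odd_oddProd (t + 9 % 2)
  obtain ⟨c, hc⟩ := Int.even_mul_pred_self t
  qify at hc
  have h1 := cast_choose_four (t + k * 2 ^ (P + 3))
  have h2 := cast_choose_four t
  refine ⟨k * (q * (2 * t ^ 3 - 9 * t ^ 2 + 11 * t - 3) + (t ^ 3 - 9 * c + t - 3)) +
    (2 * q + 1) * (k ^ 2 * 2 ^ (P + 1)) * (6 * t ^ 2 - 18 * t + 11 + (4 * t - 6) *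
      (k * 2 ^ (P + 3)) + (k * 2 ^ (P + 3)) ^ 2), 3, by decide, ?_⟩
  rw [hq]
  push_cast at h1 h2 ⊢
  linear_combination (2 * q + 1 : ℚ) / 2 * (h1 - h2) - 9 * (k * 2 ^ (P + 3)) * hc

theorem TwoDvd.coreTau_seven_sub {N : ℕ} (hN : 3 ≤ N) (k : ℕ) {t : ℕ} (ht : Odd t) :
    TwoDvd (N + 1) (_root_.coreTau (single 7 1) 6 (t + k * 2 ^ N) -
      _root_.coreTau (single 7 1) 6 t - k * 2 ^ N) := by
  have hq : (2 ^ (6 / 2) * (6 / 2).factorial : ℕ) / (gam (single 7 1) : ℚ) = 6 := by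
    rw [gam_single]
    norm_num [Nat.factorial]
  apply TwoDvd.coreTau_sub_of_factor (by omega)
  · rw [hq]
    exact TwoDvd.int 6
  rw [hq]
  obtain ⟨P, rfl⟩ := Nat.exists_eq_add_of_le' hN
  obtain ⟨q, hq⟩ := odd_oddProd (t + 6 % 2)
  have h1 := cast_choose_three (t + k * 2 ^ (P + 3))
  have h2 := cast_choose_three t
  obtain ⟨y, rfl⟩ := ht
  refine ⟨k * (q * (12 * y ^ 2 - 1) + (6 * y ^ 2 - 1)) + (2 * q + 1) * (k ^ 2 * 2 ^ (P + 2)) *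
    (6 * y + k * 2 ^ (P + 3)), 1, odd_one, ?_⟩
  rw [hq]
  push_cast at h1 h2 ⊢
  linear_combination (2 * q + 1 : ℚ) * (h1 - h2)

theorem TwoDvd.sign_mul_sub {N : ℕ} {k : ℕ} {x : ℚ} (hx : TwoDvd (N + 1) (x - k * 2 ^ N)) (j : ℕ) :
    TwoDvd (N + 1) ((-1) ^ j * x - k * 2 ^ N) := by
  rcases neg_one_pow_eq_or ℚ j with h | h <;> rw [h]
  · simpa using hx
  · convert hx.neg.sub (TwoDvd.pow_mul (N + 1) k) using 1
    push_cast
    ring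

theorem tauDiff_single_three_eq {b S l t : ℕ} (hb : 1 ≤ b) (hl : Even l) (hS : Odd (S + b))
    (ht : S + (2 * b - 1) = t + l) :
    tauDiff l S (single 3 b) =
      coreTau (single 3 b) (4 * b - 2) (t + l) - coreTau (single 3 b) (4 * b - 2) t := by
  rw [tauDiff_eq_coreTau_sub (x := 4 * b - 2) (t := t) (by simp) (by simp; omega)
    (by rw [wt_single, deg_single]; omega) hl (by omega), deg_single]
  rw [(Nat.Odd.sub_odd hS odd_one).neg_one_pow, one_mul]

theorem TwoDvd.tauDiff_three {N : ℕ} (hN : 3 ≤ N) (k : ℕ) {m S b : ℕ} (hm : Odd m)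
    (hm7 : 7 ≤ m) (hb : b = 1 ∨ b = 2 ∨ b = 3) (hS : S + 3 * b = m + k * 2 ^ N) :
    TwoDvd (N + 1) (_root_.tauDiff (k * 2 ^ N) S (single 3 b) -
      (-1) ^ ((m + 1) / 2) * (k * 2 ^ N) / 2) := by
  have hl : Even (k * 2 ^ N) := (Nat.even_pow.mpr ⟨even_two, by omega⟩).mul_left k
  have hS' : Odd (S + b) := by
    have : Odd (S + b + 2 * b) := by
      rw [show S + b + 2 * b = m + k * 2 ^ N by omega]
      exact hm.add_even hl
    exact (Nat.odd_add.mp this).mpr (even_two_mul b)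
  obtain ⟨y, rfl⟩ := hm
  rcases hb with rfl | rfl | rfl
  · obtain ⟨z, rfl⟩ := Nat.exists_eq_add_of_le' (show 1 ≤ y by omega)
    rw [tauDiff_single_three_eq (t := 2 * z + 1) le_rfl hl hS' (by omega),
      show (2 * (z + 1) + 1 + 1) / 2 = z + 2 by omega, pow_add, neg_one_sq, mul_one ((-1) ^ _)]
    exact TwoDvd.coreTau_single_three_one_sub hN k z
  · obtain ⟨z, rfl⟩ := Nat.exists_eq_add_of_le' (show 1 ≤ y by omega)
    rw [tauDiff_single_three_eq (t := 2 * z) (by norm_num) hl hS' (by omega),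
      show (2 * (z + 1) + 1 + 1) / 2 = z + 2 by omega, pow_add, neg_one_sq, mul_one ((-1) ^ _)]
    exact TwoDvd.coreTau_single_three_two_sub hN k z
  · obtain ⟨z, rfl⟩ := Nat.exists_eq_add_of_le' (show 2 ≤ y by omega)
    rw [tauDiff_single_three_eq (t := 2 * z + 1) (by norm_num) hl hS' (by omega),
      show (2 * (z + 2) + 1 + 1) / 2 = z + 1 + 2 by omega, pow_add _ (z + 1), neg_one_sq,
      mul_one ((-1) ^ _)]
    exact TwoDvd.coreTau_single_three_three_sub hN k z

theorem TwoDvd.tauDiff_three_of_four_le {N : ℕ} (hN : 3 ≤ N) (k : ℕ) {m S b : ℕ} (hm : Odd m)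
    (hmN : 2 * N + 1 ≤ m) (hb : 4 ≤ b) (hS : S + 3 * b = m + k * 2 ^ N) :
    TwoDvd (N + 1) (_root_.tauDiff (k * 2 ^ N) S (single 3 b) -
      if b ≤ 5 then (k * 2 ^ N : ℚ) else 0) := by
  have hl : Even (k * 2 ^ N) := (Nat.even_pow.mpr ⟨even_two, by omega⟩).mul_left k
  have hS' : Odd (S + b) := by
    have : Odd (S + b + 2 * b) := by
      rw [show S + b + 2 * b = m + k * 2 ^ N by omega]
      exact hm.add_even hl
    exact (Nat.odd_add.mp this).mpr (even_two_mul b)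
  obtain ⟨w, rfl⟩ := hm
  rcases Nat.lt_or_ge b (2 * w + 1) with hbm | hbm
  · obtain ⟨t, ht⟩ := Nat.exists_eq_add_of_le (show b + 1 ≤ 2 * w + 1 by omega)
    rw [tauDiff_single_three_eq (t := t) (by omega) hl hS' (by omega)]
    rcases Nat.even_or_odd' b with ⟨c, rfl | rfl⟩
    · obtain ⟨y, rfl⟩ : ∃ y, t = 2 * y := ⟨w - c, by omega⟩
      obtain ⟨c, rfl⟩ := Nat.exists_eq_add_of_le' (show 1 ≤ c by omega)
      rcases Nat.lt_or_ge c 2 with h | h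
      · obtain rfl : c = 1 := by omega
        exact TwoDvd.coreTau_single_three_four_sub hN k y
      · rw [if_neg (by omega), show 2 * (c + 1) = 2 * c + 2 by ring,
          show 4 * (2 * c + 2) - 2 = 8 * c + 6 by omega]
        exact TwoDvd.coreTau_three_even_sub_zero hN k y h
    · obtain ⟨y, rfl⟩ : ∃ y, t = 2 * y + 1 := ⟨w - c - 1, by omega⟩
      obtain ⟨c, rfl⟩ := Nat.exists_eq_add_of_le' (show 1 ≤ c by omega)
      rcases Nat.lt_or_ge c 2 with h | h
      · obtain rfl : c = 1 := by omega
        exact TwoDvd.coreTau_single_three_five_sub hN k y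
      · rw [if_neg (by omega), show 2 * (c + 1) + 1 = 2 * c + 3 by ring,
          show 4 * (2 * c + 3) - 2 = 8 * c + 10 by omega]
        exact TwoDvd.coreTau_three_odd_sub_zero hN k y h
  · rw [if_neg (by omega), sub_zero, _root_.tauDiff, if_neg (by omega), sub_zero,
      tau_single_one_add (x := 4 * b - 2) (by simp) (by rw [wt_single, deg_single]; omega)]
    apply TwoDvd.sign_mul
    rcases Nat.even_or_odd' b with ⟨c, rfl | rfl⟩
    · obtain ⟨z, hz⟩ := hS'
      obtain ⟨c, rfl⟩ := Nat.exists_eq_add_of_le' (show 1 ≤ c by omega)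
      rw [show 2 * (c + 1) = 2 * c + 2 by ring, show 4 * (2 * c + 2) - 2 = 8 * c + 6 by omega,
        show S + (8 * c + 6) / 2 = 2 * (z + c + 1) by omega, coreTau_single_three_even]
      exact ((TwoDvd.int _).mul (TwoDvd.pow_mul (2 * c + 1) ((z + c + 1).choose _))).mono (by omega)
    · obtain ⟨z, hz⟩ := hS'
      obtain ⟨c, rfl⟩ := Nat.exists_eq_add_of_le' (show 1 ≤ c by omega)
      rw [show 2 * (c + 1) + 1 = 2 * c + 3 by ring, show 4 * (2 * c + 3) - 2 = 8 * c + 10 by omega,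
        show S + (8 * c + 10) / 2 = 2 * (z + c + 1) + 1 by omega, coreTau_single_three_odd]
      exact (((TwoDvd.int _).mul
        (TwoDvd.pow_mul (2 * c + 1) ((z + c + 1).choose _))).div_odd
          ⟨c + 1, by ring⟩).mono (by omega)

theorem TwoDvd.tauDiff_of_factor {N : ℕ} (hN : 3 ≤ N) (k : ℕ) {v : ℕ →₀ ℕ} (hv : v 1 = 0)
    (hv0 : v ≠ 0) {x e : ℕ} (hx : wt v + deg v = x + 2)
    (he : e + padicValNat 2 (gam v) ≤ padicValNat 2 x.factorial)
    (hlog : x ≤ 1 ∨ Nat.log 2 x ≤ e) (hfar : x / 2 + 8 ≤ wt v → wt v ≤ 2 * e + x / 2)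
    {m S : ℕ} (hm : 2 * N + 1 ≤ m) (hS : S + wt v = m + k * 2 ^ N) :
    TwoDvd (N + 1) (_root_.tauDiff (k * 2 ^ N) S v) := by
  have hl : Even (k * 2 ^ N) := (Nat.even_pow.mpr ⟨even_two, by omega⟩).mul_left k
  rcases Nat.lt_or_ge (S + x / 2) (k * 2 ^ N) with h | h
  · rw [_root_.tauDiff, if_neg (by omega), sub_zero, tau_single_one_add hv hx]
    exact ((TwoDvd.coreTau he _).mono (by omega)).sign_mul _
  · obtain ⟨t, ht⟩ := Nat.exists_eq_add_of_le' h
    rw [tauDiff_eq_coreTau_sub hv hv0 hx hl ht]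
    exact (TwoDvd.coreTau_sub (by omega) k he hlog t).sign_mul _

theorem TwoDvd.tauDiff_three_add_two {N : ℕ} (hN : 3 ≤ N) (k : ℕ) {m S a : ℕ} (hm : 7 ≤ m)
    (ha : a = 1 ∨ a = 2) (hS : S + (3 * a + 2) = m + k * 2 ^ N) :
    TwoDvd (N + 1) (_root_.tauDiff (k * 2 ^ N) S (single 3 a + single 2 1) - k * 2 ^ N) := by
  have hl : Even (k * 2 ^ N) := (Nat.even_pow.mpr ⟨even_two, by omega⟩).mul_left k
  have hv0 : (single 3 a + single 2 1 : ℕ →₀ ℕ) ≠ 0 := by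
    intro h
    simpa using DFunLike.congr_fun h 2
  obtain ⟨t, ht⟩ := Nat.exists_eq_add_of_le' (show a + 2 ≤ m by omega)
  rw [tauDiff_eq_coreTau_sub (x := 4 * a + 1) (t := t) (by simp) hv0
    (by simp only [wt_add, deg_add, wt_single, deg_single]; omega) hl (by omega)]
  apply TwoDvd.sign_mul_sub
  rcases ha with rfl | rfl
  · exact TwoDvd.coreTau_three_add_two_sub hN k t
  · exact TwoDvd.coreTau_three_three_add_two_sub hN k t

theorem TwoDvd.tauDiff_seven {N : ℕ} (hN : 3 ≤ N) (k : ℕ) {m S : ℕ} (hm : Odd m) (hm7 : 7 ≤ m)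
    (hS : S + 7 = m + k * 2 ^ N) :
    TwoDvd (N + 1) (_root_.tauDiff (k * 2 ^ N) S (single 7 1) - k * 2 ^ N) := by
  have hl : Even (k * 2 ^ N) := (Nat.even_pow.mpr ⟨even_two, by omega⟩).mul_left k
  obtain ⟨t, rfl⟩ := Nat.exists_eq_add_of_le' (show 4 ≤ m by omega)
  rw [tauDiff_eq_coreTau_sub (x := 6) (t := t) (by simp) (by simp)
    (by simp only [wt_single, deg_single]) hl (by omega)]
  apply TwoDvd.sign_mul_sub
  exact TwoDvd.coreTau_seven_sub hN k ((Nat.odd_add.mp hm).mpr (by decide))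

theorem wt_zero : wt 0 = 0 := by simp [wt]

theorem sum_toMultiset_eq_wt (u : ℕ →₀ ℕ) : (Finsupp.toMultiset u).sum = wt u := by
  rw [Finsupp.toMultiset_apply, Finsupp.sum, Multiset.sum_sum, wt, Finsupp.sum]
  refine Finset.sum_congr rfl fun i _ => ?_
  rw [Multiset.sum_nsmul, Multiset.sum_singleton, smul_eq_mul, mul_comm]

theorem coeff_divB (n : ℕ) (u : ℕ →₀ ℕ) :
    coeff u (divB n) = if u 0 = 0 ∧ wt u = n then tau u else 0 := by
  have hwt (P : n.Partition) : P.parts.toFinsupp 0 = 0 ∧ wt P.parts.toFinsupp = n := by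
    constructor
    · rw [Multiset.toFinsupp_apply, Multiset.count_eq_zero]
      exact fun h => (P.parts_pos h).ne rfl
    · rw [← sum_toMultiset_eq_wt, Multiset.toFinsupp_toMultiset, P.parts_sum]
  simp only [divB, coeff_sum, coeff_smul, coeff_monomial, smul_eq_mul, mul_ite, mul_one, mul_zero]
  split_ifs with h
  · let P : n.Partition :=
      { parts := Finsupp.toMultiset u
        parts_pos := by
          intro i hi
          rw [Finsupp.mem_toMultiset, Finsupp.mem_support_iff] at hi
          rcases Nat.eq_zero_or_pos i with rfl | h'
          · exact absurd h.1 hi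
          · exact h'
        parts_sum := by rw [sum_toMultiset_eq_wt, h.2] }
    have hP : P.parts.toFinsupp = u := Finsupp.toMultiset_toFinsupp u
    rw [Finset.sum_eq_single P, if_pos hP, hP]
    · intro Q _ hQ
      rw [if_neg]
      intro hQu
      refine hQ (Nat.Partition.ext ?_)
      rw [← Multiset.toFinsupp_toMultiset Q.parts, hQu]
    · simp
  · refine Finset.sum_eq_zero fun P _ => if_neg ?_
    rintro rfl
    exact h (hwt P)

theorem wt_eq_add_wt_sub {u : ℕ →₀ ℕ} {l : ℕ} (h : single 1 l ≤ u) :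
    wt u = l + wt (u - single 1 l) := by
  conv_lhs => rw [← add_tsub_cancel_of_le h]
  rw [wt_add, wt_single, one_mul]

theorem coeff_X_one_pow_mul_divB (l m : ℕ) (u : ℕ →₀ ℕ) :
    coeff u (X 1 ^ l * divB m) =
      if u 0 = 0 ∧ wt u = m + l then (if l ≤ u 1 then tau (u - single 1 l) else 0) else 0 := by
  rw [X_pow_eq_monomial, coeff_monomial_mul', coeff_divB, one_mul, ← ite_and, ← ite_and]
  refine if_congr ?_ rfl rfl
  rw [Finsupp.single_le_iff]
  constructor
  · rintro ⟨h, h0, hw⟩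
    rw [wt_eq_add_wt_sub (Finsupp.single_le_iff.mpr h), hw]
    simp_all [add_comm]
  · rintro ⟨⟨h0, hw⟩, h⟩
    rw [wt_eq_add_wt_sub (Finsupp.single_le_iff.mpr h)] at hw
    exact ⟨h, by simp [h0], by omega⟩

theorem coeff_divB_sub (l m S : ℕ) {v : ℕ →₀ ℕ} (h0 : v 0 = 0) (h1 : v 1 = 0)
    (hv : S + wt v = m + l) :
    coeff (single 1 S + v) (divB (m + l)) - coeff (single 1 S + v) (X 1 ^ l * divB m) =
      tauDiff l S v := by
  have h : (single 1 S + v : ℕ →₀ ℕ) 0 = 0 ∧ wt (single 1 S + v) = m + l := by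
    simp [h0, wt_add, wt_single, hv]
  rw [coeff_divB, coeff_X_one_pow_mul_divB, if_pos h, if_pos h, tauDiff]
  congr 1
  simp only [Finsupp.add_apply, single_eq_same, h1, add_zero]
  refine if_congr Iff.rfl (congrArg tau ?_) rfl
  ext i
  rcases eq_or_ne i 1 with rfl | hi
  · simp [h1]
  · simp [hi.symm]

theorem coeff_X_one_mul_X_three {x b S a : ℕ} {s r : ℕ →₀ ℕ} (s1 : s 1 = 0) (s3 : s 3 = 0)
    (r1 : r 1 = 0) (r3 : r 3 = 0) (h : x + (3 * b + wt s) = S + (3 * a + wt r)) :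
    coeff (single 1 S + (single 3 a + r)) (X 1 ^ x * (X 3 ^ b * monomial s (1 : ℚ))) =
      if b = a ∧ s = r then 1 else 0 := by
  rw [← monomial_single_add, ← monomial_single_add, coeff_monomial]
  refine if_congr ⟨fun h' => ?_, ?_⟩ rfl rfl
  · have e1 := DFunLike.congr_fun h' 1
    have e3 := DFunLike.congr_fun h' 3
    simp [s1, r1] at e1
    simp [s3, r3] at e3
    subst e1 e3
    simpa using h'
  · rintro ⟨rfl, rfl⟩
    rw [show x = S by omega]

theorem coeff_X_one_mul_X_three_eq_zero {n x b : ℕ} {s u : ℕ →₀ ℕ} (hu : ¬(u 0 = 0 ∧ wt u = n))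
    (s0 : s 0 = 0) (h : x + (3 * b + wt s) = n) :
    coeff u (X 1 ^ x * (X 3 ^ b * monomial s (1 : ℚ))) = 0 := by
  rw [← monomial_single_add, ← monomial_single_add, coeff_monomial, if_neg]
  rintro rfl
  apply hu
  simp [s0, wt_add, wt_single, h]

theorem exists_eq_single_one_add_single_three_add (u : ℕ →₀ ℕ) (h0 : u 0 = 0) :
    ∃ S a r, u = single 1 S + (single 3 a + r) ∧ r 0 = 0 ∧ r 1 = 0 ∧ r 3 = 0 := by
  refine ⟨u 1, u 3, (u.erase 1).erase 3, ?_, by simp [h0], by simp, by simp⟩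
  have h : (u.erase 1) 3 = u 3 := by simp
  rw [← h, Finsupp.single_add_erase, Finsupp.single_add_erase]

/-- The predicted value of `tauDiff`, with `s` the value at `single 3 1`. -/
def tauDiffMain (l s : ℚ) (a : ℕ) (r : ℕ →₀ ℕ) : ℚ :=
  l * ((if 4 = a ∧ 0 = r then 1 else 0) + (if 5 = a ∧ 0 = r then 1 else 0)
      + (if 1 = a ∧ single 2 1 = r then 1 else 0) + (if 2 = a ∧ single 2 1 = r then 1 else 0)
      + (if 0 = a ∧ single 7 1 = r then 1 else 0))
    + s * (-(if 0 = a ∧ 0 = r then 1 else 0) + (if 1 = a ∧ 0 = r then 1 else 0)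
      + (if 2 = a ∧ 0 = r then 1 else 0) + (if 3 = a ∧ 0 = r then 1 else 0))

theorem TwoDvd.tauDiff_sub_main {N : ℕ} (hN : 3 ≤ N) (k : ℕ) {m S a : ℕ} {r : ℕ →₀ ℕ}
    (hm : Odd m) (hmN : 2 * N + 1 ≤ m) (h0 : r 0 = 0) (h1 : r 1 = 0) (h3 : r 3 = 0)
    (hS : S + (3 * a + wt r) = m + k * 2 ^ N) :
    TwoDvd (N + 1) (tauDiff (k * 2 ^ N) S (single 3 a + r) -
      tauDiffMain (k * 2 ^ N) ((-1) ^ ((m + 1) / 2) * (k * 2 ^ N) / 2) a r) := by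
  rcases eq_or_ne r 0 with rfl | hr
  · have hS' : S + 3 * a = m + k * 2 ^ N := by simpa [wt] using hS
    rw [add_zero]
    rcases Nat.lt_or_ge a 4 with ha | ha
    · rcases Nat.eq_zero_or_pos a with rfl | ha0
      · obtain rfl : S = m + k * 2 ^ N := by omega
        convert TwoDvd.tauDiff_zero hN k hm using 1
        simp [tauDiffMain]
      · convert TwoDvd.tauDiff_three hN k hm (by omega) (by omega : a = 1 ∨ a = 2 ∨ a = 3) hS'
          using 1
        interval_cases a <;> simp [tauDiffMain]
    · convert TwoDvd.tauDiff_three_of_four_le hN k hm hmN ha hS' using 2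
      rcases Nat.lt_or_ge 5 a with h | h
      · rw [if_neg (by omega)]
        simp [tauDiffMain, show 4 ≠ a by omega, show 5 ≠ a by omega, show 0 ≠ a by omega,
          show 1 ≠ a by omega, show 2 ≠ a by omega, show 3 ≠ a by omega]
      · interval_cases a <;> simp [tauDiffMain]
  by_cases hr2 : r = single 2 1 ∧ (a = 1 ∨ a = 2)
  · obtain ⟨rfl, ha⟩ := hr2
    rw [wt_single] at hS
    convert TwoDvd.tauDiff_three_add_two hN k (by omega) ha hS using 2
    rcases ha with rfl | rfl <;> simp [tauDiffMain, hr.symm]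
  by_cases hr7 : r = single 7 1 ∧ a = 0
  · obtain ⟨rfl, rfl⟩ := hr7
    rw [wt_single] at hS
    convert TwoDvd.tauDiff_seven hN k hm (by omega : 7 ≤ m) (by omega : S + 7 = _) using 2
    · simp
    · simp [tauDiffMain, hr.symm]
  obtain ⟨x, e, hx, he, hlog, hfar⟩ := exists_le_padicValNat_tau a r h0 h1 h3 hr
  have hv0 : single 3 a + r ≠ 0 := by simp [hr]
  have := TwoDvd.tauDiff_of_factor hN k (by simp [h1]) hv0 hx he (by tauto) hfar hmN
    (by rw [wt_add, wt_single]; exact hS)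
  convert this using 1
  rw [sub_eq_self, tauDiffMain]
  have hr' : ¬ 0 = r := fun h => hr h.symm
  have c1 : ¬ (1 = a ∧ single 2 1 = r) := fun h => hr2 ⟨h.2.symm, .inl h.1.symm⟩
  have c2 : ¬ (2 = a ∧ single 2 1 = r) := fun h => hr2 ⟨h.2.symm, .inr h.1.symm⟩
  have c7 : ¬ (0 = a ∧ single 7 1 = r) := fun h => hr7 ⟨h.2.symm, h.1.symm⟩
  simp only [hr', c1, c2, c7, and_false, if_false]
  ring

/-- universal Kummer congruence mod 2^{N+1}, case m odd:
l = k·2^N (k odd), m ≥ 2N+1 odd, n = m + l ≥ 15. -/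
theorem stmt_17 (N k : ℕ) (hN : 3 ≤ N) (hk : 1 ≤ k) (hkodd : Odd k)
    (l m n : ℕ) (hl : l = k * 2 ^ N) (hm : 2 * N + 1 ≤ m) (hmodd : Odd m)
    (hn : n = m + l) (hn15 : 15 ≤ n) :
    PCong 2 (N + 1) (divB n)
      (X 1 ^ l * divB m
        + C (l : ℚ) * (X 1 ^ (n - 12) * X 3 ^ 4 + X 1 ^ (n - 15) * X 3 ^ 5
            + X 1 ^ (n - 5) * X 2 * X 3 + X 1 ^ (n - 8) * X 2 * X 3 ^ 2
            + X 1 ^ (n - 7) * X 7)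
        + C ((-1 : ℚ) ^ ((m + 1) / 2) * (l : ℚ) / 2)
          * (- X 1 ^ n + X 1 ^ (n - 3) * X 3 + X 1 ^ (n - 6) * X 3 ^ 2
            + X 1 ^ (n - 9) * X 3 ^ 3)) := by
  intro u
  apply TwoDvd.le_pval
  have hX (i : ℕ) : monomial (single i 1) (1 : ℚ) = X i := rfl
  have e : X 1 ^ l * divB m
        + C (l : ℚ) * (X 1 ^ (n - 12) * X 3 ^ 4 + X 1 ^ (n - 15) * X 3 ^ 5
            + X 1 ^ (n - 5) * X 2 * X 3 + X 1 ^ (n - 8) * X 2 * X 3 ^ 2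
            + X 1 ^ (n - 7) * X 7)
        + C ((-1 : ℚ) ^ ((m + 1) / 2) * (l : ℚ) / 2)
          * (- X 1 ^ n + X 1 ^ (n - 3) * X 3 + X 1 ^ (n - 6) * X 3 ^ 2
            + X 1 ^ (n - 9) * X 3 ^ 3) =
      X 1 ^ l * divB m
        + C (l : ℚ) * (X 1 ^ (n - 12) * (X 3 ^ 4 * monomial 0 (1 : ℚ))
            + X 1 ^ (n - 15) * (X 3 ^ 5 * monomial 0 (1 : ℚ))
            + X 1 ^ (n - 5) * (X 3 ^ 1 * monomial (single 2 1) (1 : ℚ))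
            + X 1 ^ (n - 8) * (X 3 ^ 2 * monomial (single 2 1) (1 : ℚ))
            + X 1 ^ (n - 7) * (X 3 ^ 0 * monomial (single 7 1) (1 : ℚ)))
        + C ((-1 : ℚ) ^ ((m + 1) / 2) * (l : ℚ) / 2)
          * (-(X 1 ^ n * (X 3 ^ 0 * monomial 0 (1 : ℚ)))
            + X 1 ^ (n - 3) * (X 3 ^ 1 * monomial 0 (1 : ℚ))
            + X 1 ^ (n - 6) * (X 3 ^ 2 * monomial 0 (1 : ℚ))
            + X 1 ^ (n - 9) * (X 3 ^ 3 * monomial 0 (1 : ℚ))) := by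
    rw [hX, hX, show monomial 0 (1 : ℚ) = (1 : MvPolynomial ℕ ℚ) from rfl]
    ring
  rw [e]
  simp only [coeff_sub, coeff_add, coeff_C_mul, coeff_neg]
  by_cases hu : u 0 = 0 ∧ wt u = n
  · obtain ⟨h0, hw⟩ := hu
    obtain ⟨S, a, r, rfl, r0, r1, r3⟩ := exists_eq_single_one_add_single_three_add u h0
    rw [wt_add, wt_add, wt_single, wt_single, one_mul] at hw
    have key := TwoDvd.tauDiff_sub_main hN k hmodd hm r0 r1 r3 (by rw [hw, hn, hl])
    rw [← hl, ← coeff_divB_sub l m S (by simp [r0]) (by simp [r1])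
      (by rw [wt_add, wt_single, hw, hn]), ← hn, tauDiffMain] at key
    have hl' : (k * 2 ^ N : ℚ) = l := by rw [hl]; push_cast; rfl
    rw [hl'] at key
    have hc (x b : ℕ) (s : ℕ →₀ ℕ) (s1 : s 1 = 0) (s3 : s 3 = 0) (h : x + (3 * b + wt s) = n) :=
      coeff_X_one_mul_X_three s1 s3 r1 r3 (h.trans hw.symm)
    rw [hc (n - 12) 4 0, hc (n - 15) 5 0, hc (n - 5) 1 (single 2 1), hc (n - 8) 2 (single 2 1),
      hc (n - 7) 0 (single 7 1), hc n 0 0, hc (n - 3) 1 0, hc (n - 6) 2 0, hc (n - 9) 3 0]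
    · convert key using 1
      ring
    all_goals first | (simp; done) | (simp only [wt_single, wt_zero]; omega)
  · rw [coeff_divB, if_neg hu, coeff_X_one_pow_mul_divB, ← hn, if_neg hu]
    have hc (x b : ℕ) (s : ℕ →₀ ℕ) (s0 : s 0 = 0) (h : x + (3 * b + wt s) = n) :=
      coeff_X_one_mul_X_three_eq_zero hu s0 h
    rw [hc (n - 12) 4 0, hc (n - 15) 5 0, hc (n - 5) 1 (single 2 1), hc (n - 8) 2 (single 2 1),
      hc (n - 7) 0 (single 7 1), hc n 0 0, hc (n - 3) 1 0, hc (n - 6) 2 0, hc (n - 9) 3 0]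
    · simpa using TwoDvd.of_dvd (dvd_zero (2 ^ (N + 1)))
    all_goals first | (simp; done) | (simp only [wt_single, wt_zero]; omega)

end
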